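/- Let E ⊆ Γ be a set of multiplicity. Then there exists a nonzero distribution μ on Γ whose support is a Kronecker subset of E and whose Fourier coefficients satisfy μ̂(n) → 0 as n → −∞. -/

import Mathlib

noncomputable section

/-- An invertible contraction on a (complex) Banach space. -/
structure BanachContraction where
  X : Type
  [grp : NormedAddCommGroup X]
  [mod : NormedSpace ℂ X]
  [cpl : CompleteSpace X]
  T : X →L[ℂ] X
  Tinv : X →L[ℂ] X
  norm_le : ‖T‖ ≤ 1
  mul_inv : T * Tinv = 1
  inv_mul : Tinv * T = 1

attribute [instance] BanachContraction.grp BanachContraction.mod BanachContraction.cpl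

open Complex MeasureTheory Metric Set Filter

/-- The `n`-th Taylor coefficient of `f` at `0`, i.e. `f⁽ⁿ⁾(0)/n!`. -/
def taylorCoeff (f : ℂ → ℂ) (n : ℕ) : ℂ := iteratedDeriv n f 0 / (n.factorial : ℂ)

/-- `A⁺`, the algebra of absolutely convergent Taylor series: functions which, on the
closed unit disk, are sums of a power series with absolutely summable coefficients. -/
def APlus : Set (ℂ → ℂ) :=
  {f | ∃ a : ℕ → ℂ, Summable (fun n => ‖a n‖) ∧
    ∀ z ∈ Metric.closedBall (0 : ℂ) 1, HasSum (fun n => a n * z ^ n) (f z)}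

/-- The norm `‖f‖₁ = ∑ₙ |f⁽ⁿ⁾(0)/n!|` on `A⁺`. -/
def APlusNorm (f : ℂ → ℂ) : ℝ := ∑' n : ℕ, ‖taylorCoeff f n‖

/-- The `n`-th Fourier coefficient of (the boundary values of) `f` on the unit circle. -/
def fcoeff (f : ℂ → ℂ) (n : ℤ) : ℂ :=
  (1 / (2 * Real.pi)) * ∫ θ in (0:ℝ)..(2 * Real.pi),
    f (Complex.exp ((θ : ℂ) * Complex.I)) * Complex.exp (-(n : ℂ) * (θ : ℂ) * Complex.I)

/-- The Wiener algebra `A(Γ)` of absolutely convergent Fourier series on the unit circle,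
viewed as functions `ℂ → ℂ` (only the values on the unit circle are relevant). -/
def WienerAlg : Set (ℂ → ℂ) :=
  {f | Summable (fun n : ℤ => ‖fcoeff f n‖) ∧
    ∀ z ∈ Metric.sphere (0 : ℂ) 1, HasSum (fun n : ℤ => fcoeff f n * z ^ n) (f z)}

/-- The norm `‖f‖₁ = ∑_{n ∈ ℤ} |f̂(n)|` on `A(Γ)`. -/
def WienerNorm (f : ℂ → ℂ) : ℝ := ∑' n : ℤ, ‖fcoeff f n‖

/-- `I` is a closed ideal of `A⁺` (closedness w.r.t. the norm `APlusNorm`). -/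
def IsClosedIdealAPlus (I : Set (ℂ → ℂ)) : Prop :=
  I ⊆ APlus ∧
  (∀ f ∈ I, ∀ g ∈ I, f + g ∈ I) ∧
  (∀ f ∈ APlus, ∀ g ∈ I, f * g ∈ I) ∧
  (∀ f ∈ APlus, (∀ ε > 0, ∃ g ∈ I, APlusNorm (f - g) < ε) → f ∈ I)

/-- `J` is a closed ideal of the Wiener algebra `A(Γ)`. -/
def IsClosedIdealW (J : Set (ℂ → ℂ)) : Prop :=
  J ⊆ WienerAlg ∧
  (∀ f ∈ J, ∀ g ∈ J, f + g ∈ J) ∧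
  (∀ f ∈ WienerAlg, ∀ g ∈ J, f * g ∈ J) ∧
  (∀ f ∈ WienerAlg, (∀ ε > 0, ∃ g ∈ J, WienerNorm (f - g) < ε) → f ∈ J)

/-- `I^A` : the closed ideal generated by `I` in the Wiener algebra `A(Γ)`. -/
def IdealGenW (I : Set (ℂ → ℂ)) : Set (ℂ → ℂ) := ⋂₀ {J | IsClosedIdealW J ∧ I ⊆ J}

/-- The hull `h(I)`: common zeros in the closed unit disk of all elements of `I`. -/
def hull (I : Set (ℂ → ℂ)) : Set ℂ :=
  {z ∈ Metric.closedBall (0 : ℂ) 1 | ∀ f ∈ I, f z = 0}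

/-- `I ≠ {0}`: `I` contains an element not identically zero on the unit disk. -/
def NontrivialIdeal (I : Set (ℂ → ℂ)) : Prop :=
  ∃ f ∈ I, ∃ z ∈ Metric.ball (0 : ℂ) 1, f z ≠ 0

/-- `H^∞(D)`: bounded holomorphic functions on the open unit disk. -/
def Hinf : Set (ℂ → ℂ) :=
  {f | DifferentiableOn ℂ f (Metric.ball (0 : ℂ) 1) ∧
    ∃ C : ℝ, ∀ z ∈ Metric.ball (0 : ℂ) 1, ‖f z‖ ≤ C}

/-- An inner function: a bounded-by-one holomorphic function on the unit disk whose
radial limits have modulus `1` at almost every boundary point. -/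
def IsInnerFunction (u : ℂ → ℂ) : Prop :=
  DifferentiableOn ℂ u (Metric.ball (0 : ℂ) 1) ∧
  (∀ z ∈ Metric.ball (0 : ℂ) 1, ‖u z‖ ≤ 1) ∧
  ∀ᵐ (θ : ℝ) ∂(MeasureTheory.volume.restrict (Set.Ioc (0 : ℝ) (2 * Real.pi))),
    Filter.Tendsto (fun r : ℝ => ‖u ((r : ℂ) * Complex.exp ((θ : ℂ) * Complex.I))‖)
      (nhdsWithin 1 (Set.Iio 1)) (nhds 1)

/-- `S` divides (the inner factor of) `f`, i.e. `f ∈ S·H^∞`. -/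
def InnerDivides (S f : ℂ → ℂ) : Prop :=
  ∃ g ∈ Hinf, ∀ z ∈ Metric.ball (0 : ℂ) 1, f z = S z * g z

/-- `S` is a greatest common divisor of the inner factors of the nonzero elements of `I`:
`S` is inner, divides every nonzero element of `I`, and every inner function with this
property divides `S`. -/
def IsGcdInner (I : Set (ℂ → ℂ)) (S : ℂ → ℂ) : Prop :=
  IsInnerFunction S ∧
  (∀ f ∈ I, (∃ z ∈ Metric.ball (0 : ℂ) 1, f z ≠ 0) → InnerDivides S f) ∧
  ∀ S' : ℂ → ℂ, IsInnerFunction S' →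
    (∀ f ∈ I, (∃ z ∈ Metric.ball (0 : ℂ) 1, f z ≠ 0) → InnerDivides S' f) →
    InnerDivides S' S

/-- The perfect symmetric set `E_ξ` of constant ratio `ξ` on the unit circle. -/
def Eset (ξ : ℝ) : Set ℂ :=
  {z | ∃ ε : ℕ → ℕ, (∀ k, ε k ≤ 1) ∧
    z = Complex.exp (2 * Real.pi * Complex.I *
      (((1 - ξ) * ∑' k : ℕ, (ε k : ℝ) * ξ ^ k : ℝ) : ℂ))}

/-- A Carleson set: a closed subset of the unit circle with
`∫_{-π}^{π} log (2 / dist(e^{iθ}, E)) dθ < ∞`. -/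
def IsCarleson (E : Set ℂ) : Prop :=
  IsClosed E ∧ E ⊆ Metric.sphere (0 : ℂ) 1 ∧
  MeasureTheory.IntegrableOn
    (fun θ : ℝ => Real.log (2 / Metric.infDist (Complex.exp ((θ : ℂ) * Complex.I)) E))
    (Set.Ioc (-Real.pi) Real.pi)

/-- The division ideal `I(f) = {g ∈ A⁺ : fg ∈ I}`. -/
def Idiv (I : Set (ℂ → ℂ)) (f : ℂ → ℂ) : Set (ℂ → ℂ) := {g ∈ APlus | f * g ∈ I}

/-- `f` belongs to `A^∞(D)` and vanishes on `E` together with all its derivatives: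
`f` is holomorphic on the disk, and each derivative extends continuously to the closed
disk with the extension vanishing on `E`. -/
def VanishAllDeriv (E : Set ℂ) (f : ℂ → ℂ) : Prop :=
  ContinuousOn f (Metric.closedBall (0 : ℂ) 1) ∧
  DifferentiableOn ℂ f (Metric.ball (0 : ℂ) 1) ∧
  (∀ z ∈ E, f z = 0) ∧
  ∀ n : ℕ, ∃ g : ℂ → ℂ, ContinuousOn g (Metric.closedBall (0 : ℂ) 1) ∧
    Set.EqOn g (iteratedDeriv n f) (Metric.ball (0 : ℂ) 1) ∧ ∀ z ∈ E, g z = 0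

/-- `J₀⁺(E)`: the closure in `A⁺` of the set of elements of `A^∞(D)` vanishing on `E`
together with all their derivatives. -/
def J0Plus (E : Set ℂ) : Set (ℂ → ℂ) :=
  {f | f ∈ APlus ∧ ∀ ε > 0, ∃ g ∈ APlus, VanishAllDeriv E g ∧ APlusNorm (f - g) < ε}

/-- `I⁺(E) = {f ∈ A⁺ : f ≡ 0 on E}`. -/
def IPlus (E : Set ℂ) : Set (ℂ → ℂ) := {f ∈ APlus | ∀ z ∈ E, f z = 0}

/-- The pairing of `f ∈ A⁺ ≅ ℓ¹(ℕ)` with an element `c ∈ c₀`. -/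
def pairing (f : ℂ → ℂ) (c : ℕ → ℂ) : ℂ := ∑' n : ℕ, taylorCoeff f n * c n

/-- `S` is dense in `A⁺` for the weak-star topology `σ(ℓ¹, c₀)`. -/
def WStarDense (S : Set (ℂ → ℂ)) : Prop :=
  ∀ f ∈ APlus, ∀ (m : ℕ) (c : Fin m → ℕ → ℂ),
    (∀ i, Filter.Tendsto (c i) Filter.atTop (nhds 0)) →
    ∀ ε > 0, ∃ g ∈ S, ∀ i, ‖pairing f (c i) - pairing g (c i)‖ < ε

/-- `S` is closed in `A⁺` for the weak-star topology `σ(ℓ¹, c₀)`. -/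
def WStarClosed (S : Set (ℂ → ℂ)) : Prop :=
  S ⊆ APlus ∧
  ∀ f ∈ APlus,
    (∀ (m : ℕ) (c : Fin m → ℕ → ℂ),
      (∀ i, Filter.Tendsto (c i) Filter.atTop (nhds 0)) →
      ∀ ε > 0, ∃ g ∈ S, ∀ i, ‖pairing f (c i) - pairing g (c i)‖ < ε) → f ∈ S

/-- A Kronecker set: a compact subset of the unit circle on which every continuous
unimodular function is a uniform limit of characters `z ↦ zⁿ`, `n ∈ ℤ`. -/
def IsKronecker (K : Set ℂ) : Prop :=
  IsCompact K ∧ K ⊆ Metric.sphere (0 : ℂ) 1 ∧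
  ∀ f : ℂ → ℂ, ContinuousOn f K → (∀ z ∈ K, ‖f z‖ = 1) →
    ∀ ε > 0, ∃ n : ℤ, ∀ z ∈ K, ‖f z - z ^ n‖ < ε

/-- A Helson set: a compact subset of the unit circle on which every continuous function
is the restriction of an element of the Wiener algebra. -/
def IsHelson (K : Set ℂ) : Prop :=
  IsCompact K ∧ K ⊆ Metric.sphere (0 : ℂ) 1 ∧
  ∀ f : ℂ → ℂ, ContinuousOn f K → ∃ g ∈ WienerAlg, ∀ z ∈ K, f z = g z

/-- The little Lipschitz class `Λ_α(D)`: disc-algebra functions with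
`|f(e^{it₁}) - f(e^{it₂})| / |t₁-t₂|^α → 0` uniformly as `|t₁-t₂| → 0`. -/
def LittleLip (α : ℝ) (f : ℂ → ℂ) : Prop :=
  ContinuousOn f (Metric.closedBall (0 : ℂ) 1) ∧
  DifferentiableOn ℂ f (Metric.ball (0 : ℂ) 1) ∧
  ∀ ε > 0, ∃ δ > 0, ∀ t₁ t₂ : ℝ, t₁ ≠ t₂ → |t₁ - t₂| < δ →
    ‖f (Complex.exp ((t₁ : ℂ) * Complex.I)) - f (Complex.exp ((t₂ : ℂ) * Complex.I))‖ ≤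
      ε * |t₁ - t₂| ^ α

/-- The perfect part of a set: the union of all its perfect subsets. -/
def perfectPart (C : Set ℂ) : Set ℂ := ⋃₀ {P | Perfect P ∧ P ⊆ C}

/-- A distribution on the unit circle, encoded by its sequence of Fourier coefficients
`μ̂(n) = μ(e^{-int})`, which has polynomial growth. -/
structure CircleDistribution where
  coeff : ℤ → ℂ
  growth : ∃ (C : ℝ) (k : ℕ), ∀ n : ℤ, ‖coeff n‖ ≤ C * (1 + (n.natAbs : ℝ)) ^ k

/-- A smooth `2π`-periodic function (test function on the circle). -/
def PeriodicSmooth (φ : ℝ → ℂ) : Prop :=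
  ContDiff ℝ (⊤ : ℕ∞) φ ∧ ∀ θ : ℝ, φ (θ + 2 * Real.pi) = φ θ

/-- Fourier coefficients of a test function. -/
def testCoeff (φ : ℝ → ℂ) (n : ℤ) : ℂ :=
  (1 / (2 * Real.pi)) * ∫ θ in (0:ℝ)..(2 * Real.pi),
    φ θ * Complex.exp (-(n : ℂ) * (θ : ℂ) * Complex.I)

/-- The action of a distribution on a test function: `μ(φ) = ∑ₙ μ̂(n) φ̂(-n)`. -/
def distAct (μ : CircleDistribution) (φ : ℝ → ℂ) : ℂ := ∑' n : ℤ, μ.coeff n * testCoeff φ (-n)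

/-- The support of a distribution on the circle: the points of the circle having no open
neighbourhood `U` such that `μ` kills every test function supported in `U`. -/
def distSupport (μ : CircleDistribution) : Set ℂ :=
  {z ∈ Metric.sphere (0 : ℂ) 1 | ∀ U : Set ℂ, IsOpen U → z ∈ U →
    ∃ φ : ℝ → ℂ, PeriodicSmooth φ ∧
      (∀ θ : ℝ, Complex.exp ((θ : ℂ) * Complex.I) ∉ U → φ θ = 0) ∧ distAct μ φ ≠ 0}

/-- A set of multiplicity: a closed subset of the circle supporting a nonzero
pseudofunction (distribution whose Fourier coefficients tend to `0` as `|n| → ∞`). -/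
def IsMSet (E : Set ℂ) : Prop :=
  IsClosed E ∧ E ⊆ Metric.sphere (0 : ℂ) 1 ∧
  ∃ μ : CircleDistribution, μ.coeff ≠ 0 ∧ distSupport μ ⊆ E ∧
    Filter.Tendsto μ.coeff Filter.cofinite (nhds 0)

/-- A Dirichlet set: `sup_{z ∈ E} |z^{n_k} - 1| → 0` for some sequence `n_k → ∞`. -/
def IsDirichletSet (E : Set ℂ) : Prop :=
  ∃ n : ℕ → ℕ, Filter.Tendsto n Filter.atTop Filter.atTop ∧
    ∀ ε > 0, ∀ᶠ k in Filter.atTop, ∀ z ∈ E, ‖z ^ (n k) - 1‖ < ε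

lemma PeriodicSmooth.periodic {φ : ℝ → ℂ} (hφ : PeriodicSmooth φ) :
    Function.Periodic φ (2 * Real.pi) := hφ.2

lemma PeriodicSmooth.continuous {φ : ℝ → ℂ} (hφ : PeriodicSmooth φ) : Continuous φ :=
  hφ.1.continuous

lemma PeriodicSmooth.mul {φ ψ : ℝ → ℂ} (hφ : PeriodicSmooth φ) (hψ : PeriodicSmooth ψ) :
    PeriodicSmooth (fun θ => φ θ * ψ θ) :=
  ⟨hφ.1.mul hψ.1, fun θ => by simp only [hφ.2, hψ.2]⟩

lemma PeriodicSmooth.sub {φ ψ : ℝ → ℂ} (hφ : PeriodicSmooth φ) (hψ : PeriodicSmooth ψ) :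
    PeriodicSmooth (fun θ => φ θ - ψ θ) :=
  ⟨hφ.1.sub hψ.1, fun θ => by simp only [hφ.2, hψ.2]⟩

lemma PeriodicSmooth.deriv {φ : ℝ → ℂ} (hφ : PeriodicSmooth φ) : PeriodicSmooth (deriv φ) := by
  refine ⟨(contDiff_infty_iff_deriv.1 hφ.1).2, fun θ => ?_⟩
  rw [← deriv_comp_add_const]
  congr 1
  exact funext hφ.2

lemma PeriodicSmooth.hasDerivAt {φ : ℝ → ℂ} (hφ : PeriodicSmooth φ) (θ : ℝ) :
    HasDerivAt φ (_root_.deriv φ θ) θ :=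
  ((contDiff_infty_iff_deriv.1 hφ.1).1 θ).hasDerivAt

lemma PeriodicSmooth.exists_bound {φ : ℝ → ℂ} (hφ : PeriodicSmooth φ) :
    ∃ C, ∀ θ, ‖φ θ‖ ≤ C := by
  obtain ⟨C, hC⟩ := (isCompact_Icc (a := (0 : ℝ)) (b := 2 * Real.pi)).exists_bound_of_continuousOn
    hφ.continuous.continuousOn
  refine ⟨C, fun θ => ?_⟩
  obtain ⟨y, hy, hθy⟩ := hφ.periodic.exists_mem_Ico₀ Real.two_pi_pos θ
  rw [hθy]
  exact hC y ⟨hy.1, hy.2.le⟩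

lemma exp_int_mul_add_two_pi (n : ℤ) (θ : ℝ) :
    Complex.exp ((n : ℂ) * ((θ + 2 * Real.pi : ℝ) : ℂ) * Complex.I) =
      Complex.exp ((n : ℂ) * (θ : ℂ) * Complex.I) := by
  have : (n : ℂ) * ((θ + 2 * Real.pi : ℝ) : ℂ) * Complex.I =
      (n : ℂ) * (θ : ℂ) * Complex.I + n * (2 * Real.pi * Complex.I) := by
    push_cast; ring
  rw [this, Complex.exp_add, Complex.exp_int_mul_two_pi_mul_I, mul_one]

lemma norm_exp_int_mul (n : ℤ) (θ : ℝ) :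
    ‖Complex.exp ((n : ℂ) * (θ : ℂ) * Complex.I)‖ = 1 := by
  have := Complex.norm_exp_ofReal_mul_I ((n : ℝ) * θ)
  simpa using this

lemma norm_exp_neg_int_mul (n : ℤ) (θ : ℝ) :
    ‖Complex.exp (-(n : ℂ) * (θ : ℂ) * Complex.I)‖ = 1 := by
  simpa using norm_exp_int_mul (-n) θ

lemma norm_testCoeff_le {φ : ℝ → ℂ} {C : ℝ} (hC : ∀ θ, ‖φ θ‖ ≤ C) (n : ℤ) :
    ‖testCoeff φ n‖ ≤ C := by
  have h := intervalIntegral.norm_integral_le_of_norm_le_const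
    (f := fun θ : ℝ => φ θ * Complex.exp (-(n : ℂ) * (θ : ℂ) * Complex.I)) (a := 0)
    (b := 2 * Real.pi) (C := C) (fun θ _ => by
      rw [norm_mul, norm_exp_neg_int_mul, mul_one]; exact hC θ)
  have hpi := Real.two_pi_pos
  have h1 : ‖(1 / (2 * Real.pi) : ℂ)‖ = 1 / (2 * Real.pi) := by
    have : (1 / (2 * Real.pi) : ℂ) = ((1 / (2 * Real.pi) : ℝ) : ℂ) := by push_cast; rfl
    rw [this, Complex.norm_real, Real.norm_of_nonneg (by positivity)]
  rw [testCoeff, norm_mul, h1]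
  rw [sub_zero, abs_of_pos hpi] at h
  calc _ ≤ 1 / (2 * Real.pi) * (C * (2 * Real.pi)) := by gcongr
    _ = C := by field_simp

lemma testCoeff_deriv {φ : ℝ → ℂ} (hφ : PeriodicSmooth φ) (n : ℤ) :
    testCoeff (deriv φ) n = n * Complex.I * testCoeff φ n := by
  have hv : ∀ θ : ℝ, HasDerivAt (fun θ : ℝ => Complex.exp (-(n : ℂ) * (θ : ℂ) * Complex.I))
      (Complex.exp (-(n : ℂ) * (θ : ℂ) * Complex.I) * (-(n : ℂ) * Complex.I)) θ := by
    intro θ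
    have h1 : HasDerivAt (fun θ : ℝ => (θ : ℂ)) 1 θ := Complex.ofRealCLM.hasDerivAt
    simpa using ((h1.const_mul (-(n : ℂ))).mul_const Complex.I).cexp
  have hper : Complex.exp (-(n : ℂ) * ((2 * Real.pi : ℝ) : ℂ) * Complex.I) = 1 := by
    simpa using exp_int_mul_add_two_pi (-n) 0
  have h := intervalIntegral.integral_deriv_mul_eq_sub (a := 0) (b := 2 * Real.pi)
    (u := φ) (u' := deriv φ)
    (v := fun θ : ℝ => Complex.exp (-(n : ℂ) * (θ : ℂ) * Complex.I))
    (v' := fun θ : ℝ => Complex.exp (-(n : ℂ) * (θ : ℂ) * Complex.I) * (-(n : ℂ) * Complex.I))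
    (fun θ _ => hφ.hasDerivAt θ) (fun θ _ => hv θ)
    (hφ.deriv.continuous.intervalIntegrable _ _)
    (Continuous.intervalIntegrable (by fun_prop) _ _)
  have h0 : φ (2 * Real.pi) = φ 0 := by simpa using hφ.2 0
  rw [hper, h0] at h
  have hc := hφ.continuous
  have hc' := hφ.deriv.continuous
  rw [intervalIntegral.integral_add (Continuous.intervalIntegrable (by fun_prop) _ _)
    (Continuous.intervalIntegrable (by fun_prop) _ _)] at h
  have h2 : ∫ θ in (0 : ℝ)..(2 * Real.pi), φ θ *
      (Complex.exp (-(n : ℂ) * (θ : ℂ) * Complex.I) * (-(n : ℂ) * Complex.I)) =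
      (∫ θ in (0 : ℝ)..(2 * Real.pi), φ θ * Complex.exp (-(n : ℂ) * (θ : ℂ) * Complex.I)) *
        (-(n : ℂ) * Complex.I) := by
    rw [← intervalIntegral.integral_mul_const]
    simp only [mul_assoc]
  rw [h2] at h
  simp only [ofReal_zero, mul_zero, zero_mul, Complex.exp_zero, mul_one, sub_self] at h
  rw [testCoeff, testCoeff, eq_neg_of_add_eq_zero_left h]
  ring

lemma exists_testCoeff_decay (j : ℕ) {φ : ℝ → ℂ} (hφ : PeriodicSmooth φ) :
    ∃ C, ∀ n : ℤ, (1 + |(n : ℝ)|) ^ j * ‖testCoeff φ n‖ ≤ C := by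
  induction j generalizing φ with
  | zero =>
    obtain ⟨C, hC⟩ := hφ.exists_bound
    exact ⟨C, fun n => by simpa using norm_testCoeff_le hC n⟩
  | succ j ih =>
    obtain ⟨C, hC⟩ := ih hφ
    obtain ⟨C', hC'⟩ := ih hφ.deriv
    refine ⟨C + C', fun n => ?_⟩
    have h := hC' n
    rw [testCoeff_deriv hφ, norm_mul, norm_mul, Complex.norm_I, mul_one, Complex.norm_intCast] at h
    have := hC n
    calc _ = (1 + |(n : ℝ)|) ^ j * ‖testCoeff φ n‖ +
        (1 + |(n : ℝ)|) ^ j * (|(n : ℝ)| * ‖testCoeff φ n‖) := by ring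
      _ ≤ C + C' := add_le_add this h

lemma summable_inv_one_add_abs_sq : Summable fun n : ℤ => ((1 + |(n : ℝ)|) ^ 2)⁻¹ := by
  have h := (Real.summable_one_div_int_add_rpow (1 / 2) 2).2 (by norm_num)
  refine h.of_nonneg_of_le (fun n => by positivity) fun n => ?_
  have hpos : 0 < |(n : ℝ) + 1 / 2| := by
    rw [abs_pos]
    intro h0
    have h1 : (2 * n + 1 : ℝ) = 0 := by linarith
    have h2 : (2 * n + 1 : ℤ) = 0 := by exact_mod_cast h1
    omega
  have hle : |(n : ℝ) + 1 / 2| ≤ 1 + |(n : ℝ)| := by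
    refine (abs_add_le _ _).trans ?_
    rw [abs_of_pos (by norm_num : (0 : ℝ) < 1 / 2)]
    linarith
  rw [one_div, Real.rpow_two]
  gcongr

lemma summable_weighted_testCoeff {φ : ℝ → ℂ} (hφ : PeriodicSmooth φ) :
    Summable fun n : ℤ => (1 + |(n : ℝ)|) * ‖testCoeff φ n‖ := by
  obtain ⟨C, hC⟩ := exists_testCoeff_decay 3 hφ
  refine (summable_inv_one_add_abs_sq.mul_left C).of_nonneg_of_le
    (fun n => by positivity) fun n => ?_
  have hp : 0 < 1 + |(n : ℝ)| := by positivity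
  rw [← div_eq_mul_inv, le_div_iff₀ (by positivity)]
  calc _ = (1 + |(n : ℝ)|) ^ 3 * ‖testCoeff φ n‖ := by ring
    _ ≤ C := hC n

lemma summable_norm_testCoeff {φ : ℝ → ℂ} (hφ : PeriodicSmooth φ) :
    Summable fun n : ℤ => ‖testCoeff φ n‖ := by
  refine (summable_weighted_testCoeff hφ).of_nonneg_of_le (fun n => by positivity) fun n => ?_
  have : 0 ≤ |(n : ℝ)| * ‖testCoeff φ n‖ := by positivity
  linarith

lemma hasSum_testCoeff {φ : ℝ → ℂ} (hφ : PeriodicSmooth φ) (θ : ℝ) :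
    HasSum (fun n : ℤ => testCoeff φ n * Complex.exp ((n : ℂ) * (θ : ℂ) * Complex.I)) (φ θ) := by
  have : Fact (0 < 2 * Real.pi) := ⟨Real.two_pi_pos⟩
  let f : C(AddCircle (2 * Real.pi), ℂ) :=
    ⟨hφ.periodic.lift, continuous_coinduced_dom.mpr hφ.continuous⟩
  have hexp : ∀ (n : ℤ) (x : ℝ), (fourier n (x : AddCircle (2 * Real.pi)) : ℂ) =
      Complex.exp ((n : ℂ) * (x : ℂ) * Complex.I) := by
    intro n x
    rw [fourier_coe_apply]
    congr 1
    have : (Real.pi : ℂ) ≠ 0 := by exact_mod_cast Real.pi_ne_zero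
    push_cast
    field_simp
  have hcoeff : ∀ n, fourierCoeff f n = testCoeff φ n := by
    intro n
    rw [fourierCoeff_eq_intervalIntegral f n 0, testCoeff, zero_add, Complex.real_smul]
    push_cast
    congr 1
    refine intervalIntegral.integral_congr fun x _ => ?_
    simp only [smul_eq_mul]
    rw [hexp, mul_comm]
    push_cast
    rfl
  have hs : Summable (fourierCoeff f) := by
    rw [funext hcoeff]
    exact (summable_norm_testCoeff hφ).of_norm
  have := has_pointwise_sum_fourier_series_of_summable hs (θ : AddCircle (2 * Real.pi))
  simp only [hcoeff, hexp, smul_eq_mul] at this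
  exact this

lemma integral_exp_int_mul (n : ℤ) :
    ∫ θ in (0 : ℝ)..(2 * Real.pi), Complex.exp ((n : ℂ) * (θ : ℂ) * Complex.I) =
      if n = 0 then 2 * Real.pi else 0 := by
  split_ifs with hn
  · simp [hn]
  · have hc : (n : ℂ) * Complex.I ≠ 0 := by simp [hn]
    have h := integral_exp_mul_complex (a := 0) (b := 2 * Real.pi) hc
    have he : ∀ θ : ℝ, (n : ℂ) * Complex.I * θ = (n : ℂ) * θ * Complex.I := fun θ => by ring
    simp only [he] at h
    rw [h]
    have hper := exp_int_mul_add_two_pi n 0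
    rw [zero_add] at hper
    rw [hper]
    simp

/-- The coefficients of an absolutely convergent Fourier series are determined by its sum. -/
lemma testCoeff_eq_of_hasSum {φ : ℝ → ℂ} {a : ℤ → ℂ} (ha : Summable fun n => ‖a n‖)
    (h : ∀ θ : ℝ, HasSum (fun n : ℤ => a n * Complex.exp ((n : ℂ) * (θ : ℂ) * Complex.I)) (φ θ))
    (n : ℤ) : testCoeff φ n = a n := by
  have hint := intervalIntegral.hasSum_integral_of_dominated_convergence
    (μ := volume) (a := 0) (b := 2 * Real.pi)
    (F := fun k : ℤ => fun θ : ℝ => a k * Complex.exp ((k : ℂ) * (θ : ℂ) * Complex.I) *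
      Complex.exp (-(n : ℂ) * (θ : ℂ) * Complex.I))
    (f := fun θ => φ θ * Complex.exp (-(n : ℂ) * (θ : ℂ) * Complex.I))
    (fun k _ => ‖a k‖)
    (fun k => (Continuous.aestronglyMeasurable (by fun_prop)))
    (fun k => ae_of_all _ fun θ _ => by
      rw [norm_mul, norm_mul, norm_exp_int_mul, norm_exp_neg_int_mul, mul_one, mul_one])
    (ae_of_all _ fun θ _ => ha) (by simp)
    (ae_of_all _ fun θ _ => (h θ).mul_right _)
  have hk : ∀ k : ℤ, ∫ θ in (0 : ℝ)..(2 * Real.pi),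
      a k * Complex.exp ((k : ℂ) * (θ : ℂ) * Complex.I) *
        Complex.exp (-(n : ℂ) * (θ : ℂ) * Complex.I) =
      if k = n then a n * (2 * Real.pi) else 0 := by
    intro k
    have h1 : ∀ θ : ℝ, a k * Complex.exp ((k : ℂ) * (θ : ℂ) * Complex.I) *
        Complex.exp (-(n : ℂ) * (θ : ℂ) * Complex.I) =
        a k * Complex.exp (((k - n : ℤ) : ℂ) * (θ : ℂ) * Complex.I) := by
      intro θ
      rw [mul_assoc, ← Complex.exp_add]
      congr 2
      push_cast
      ring
    simp only [h1]
    rw [intervalIntegral.integral_const_mul, integral_exp_int_mul]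
    by_cases hkn : k = n
    · simp [hkn]
    · simp [hkn, sub_eq_zero]
  simp only [hk] at hint
  have := hint.unique (hasSum_ite_eq n _)
  rw [testCoeff, this]
  have : (Real.pi : ℂ) ≠ 0 := by exact_mod_cast Real.pi_ne_zero
  field_simp

/-- Convolution of sequences indexed by `ℤ`. -/
def seqConv (a S : ℤ → ℂ) (m : ℤ) : ℂ := ∑' k : ℤ, a k * S (m - k)

/-- The action on a test function of the distribution with Fourier coefficients `S`. -/
def seqAct (S : ℤ → ℂ) (φ : ℝ → ℂ) : ℂ := ∑' n : ℤ, S n * testCoeff φ (-n)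

lemma summable_seqConv_term {a S : ℤ → ℂ} {B : ℝ} (ha : Summable fun n => ‖a n‖)
    (hS : ∀ n, ‖S n‖ ≤ B) (m : ℤ) : Summable fun k => ‖a k * S (m - k)‖ := by
  refine (ha.mul_right B).of_nonneg_of_le (fun k => norm_nonneg _) fun k => ?_
  rw [norm_mul]
  gcongr
  exact hS _

lemma norm_seqConv_le {a S : ℤ → ℂ} {B : ℝ} (ha : Summable fun n => ‖a n‖)
    (hS : ∀ n, ‖S n‖ ≤ B) (m : ℤ) : ‖seqConv a S m‖ ≤ (∑' n, ‖a n‖) * B := by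
  rw [← tsum_mul_right]
  refine (norm_tsum_le_tsum_norm (summable_seqConv_term ha hS m)).trans ?_
  refine (summable_seqConv_term ha hS m).tsum_le_tsum (fun k => ?_) (ha.mul_right B)
  rw [norm_mul]
  gcongr
  exact hS _

lemma tendsto_seqConv_cofinite {a S : ℤ → ℂ} (ha : Summable fun n => ‖a n‖)
    {B : ℝ} (hB : ∀ n, ‖S n‖ ≤ B) (hS : Tendsto S cofinite (nhds 0)) :
    Tendsto (seqConv a S) cofinite (nhds 0) := by
  have h := tendsto_tsum_of_dominated_convergence (𝓕 := cofinite)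
    (f := fun (m : ℤ) (k : ℤ) => a k * S (m - k)) (g := fun _ => 0)
    (bound := fun k => ‖a k‖ * B) (ha.mul_right B)
    (fun k => by
      have h1 : Tendsto (fun m : ℤ => S (m - k)) cofinite (nhds 0) :=
        hS.comp (sub_left_injective (b := k)).tendsto_cofinite
      simpa using h1.const_mul (a k))
    (Eventually.of_forall fun m k => by
      rw [norm_mul]
      gcongr
      exact hB _)
  rw [tsum_zero] at h
  exact h

lemma exists_bound_of_tendsto_cofinite {S : ℤ → ℂ} (hS : Tendsto S cofinite (nhds 0)) :
    ∃ B, 0 ≤ B ∧ ∀ n, ‖S n‖ ≤ B := by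
  have h := (hS.norm).bddAbove_range_of_cofinite
  obtain ⟨B, hB⟩ := h
  exact ⟨B, (norm_nonneg _).trans (hB ⟨0, rfl⟩), fun n => hB ⟨n, rfl⟩⟩

/-- The bijection `(k, m) ↦ (k, m - k)` of `ℤ × ℤ`. -/
def intShear : ℤ × ℤ ≃ ℤ × ℤ where
  toFun p := (p.1, p.2 - p.1)
  invFun p := (p.1, p.2 + p.1)
  left_inv p := by simp
  right_inv p := by simp

lemma summable_seqConv {a b : ℤ → ℂ} (ha : Summable fun n => ‖a n‖)
    (hb : Summable fun n => ‖b n‖) : Summable fun m => ‖seqConv a b m‖ := by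
  have h := (summable_mul_of_summable_norm (f := fun n => ‖a n‖) (g := fun n => ‖b n‖)
    (by simpa using ha) (by simpa using hb))
  have h2 : Summable fun p : ℤ × ℤ => ‖a p.1‖ * ‖b (p.2 - p.1)‖ :=
    (intShear.summable_iff (f := fun p : ℤ × ℤ => ‖a p.1‖ * ‖b p.2‖)).2 h
  have h3 := h2.prod_symm.prod
  have h4 := h2.prod_symm.prod_factor
  refine h3.of_nonneg_of_le (fun m => norm_nonneg _) fun m => ?_
  have h5 : Summable fun k => ‖a k * b (m - k)‖ := by simpa using h4 m
  refine (norm_tsum_le_tsum_norm h5).trans (le_of_eq ?_)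
  simp

lemma hasSum_seqConv_mul {a b e : ℤ → ℂ} (ha : Summable fun n => ‖a n‖)
    (hb : Summable fun n => ‖b n‖) (hen : ∀ n, ‖e n‖ = 1) (hadd : ∀ k l, e (k + l) = e k * e l)
    {x y : ℂ} (hx : HasSum (fun n => a n * e n) x) (hy : HasSum (fun n => b n * e n) y) :
    HasSum (fun m => seqConv a b m * e m) (x * y) := by
  have ha' : Summable fun n => ‖a n * e n‖ := by simpa [hen] using ha
  have hb' : Summable fun n => ‖b n * e n‖ := by simpa [hen] using hb
  have hsum := summable_mul_of_summable_norm ha' hb'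
  have hprod := hx.mul hy hsum
  have hprod2 : HasSum (fun p : ℤ × ℤ => a p.1 * b (p.2 - p.1) * e p.2) (x * y) := by
    have heq : (fun p : ℤ × ℤ => a p.1 * b (p.2 - p.1) * e p.2) =
        (fun p : ℤ × ℤ => a p.1 * e p.1 * (b p.2 * e p.2)) ∘ intShear := by
      funext p
      have : e p.2 = e p.1 * e (p.2 - p.1) := by rw [← hadd]; congr 1; ring
      simp only [Function.comp, intShear, Equiv.coe_fn_mk, this]
      ring
    rw [heq, intShear.hasSum_iff]
    exact hprod
  have hswap : HasSum (fun p : ℤ × ℤ => a p.2 * b (p.1 - p.2) * e p.1) (x * y) :=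
    (Equiv.prodComm ℤ ℤ).hasSum_iff.2 hprod2
  have hB : ∀ n, ‖b n‖ ≤ ∑' k, ‖b k‖ := fun n => hb.le_tsum n fun _ _ => norm_nonneg _
  exact hswap.prod_fiberwise fun m =>
    ((summable_seqConv_term ha hB m).of_norm.hasSum).mul_right _

lemma testCoeff_mul {φ ψ : ℝ → ℂ} (hφ : PeriodicSmooth φ) (hψ : PeriodicSmooth ψ) (m : ℤ) :
    testCoeff (fun θ => φ θ * ψ θ) m = seqConv (testCoeff φ) (testCoeff ψ) m := by
  have ha := summable_norm_testCoeff hφ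
  have hb := summable_norm_testCoeff hψ
  refine testCoeff_eq_of_hasSum (summable_seqConv ha hb) (fun θ => ?_) m
  refine hasSum_seqConv_mul (e := fun n : ℤ => Complex.exp ((n : ℂ) * (θ : ℂ) * Complex.I))
    ha hb (fun n => norm_exp_int_mul n θ) (fun k l => ?_)
    (hasSum_testCoeff hφ θ) (hasSum_testCoeff hψ θ)
  rw [← Complex.exp_add]
  congr 1
  push_cast
  ring

lemma seqAct_seqConv {φ ψ : ℝ → ℂ} (hφ : PeriodicSmooth φ) (hψ : PeriodicSmooth ψ)
    {S : ℤ → ℂ} {B : ℝ} (hS : ∀ n, ‖S n‖ ≤ B) :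
    seqAct (seqConv (testCoeff φ) S) ψ = seqAct S (fun θ => φ θ * ψ θ) := by
  have ha := summable_norm_testCoeff hφ
  have hb := summable_norm_testCoeff hψ
  have hbn : Summable fun n : ℤ => ‖testCoeff ψ (-n)‖ := (Equiv.neg ℤ).summable_iff.2 hb
  have hsum : Summable fun p : ℤ × ℤ => testCoeff φ p.1 * S (p.2 - p.1) * testCoeff ψ (-p.2) := by
    have h := (summable_mul_of_summable_norm (f := fun n => ‖testCoeff φ n‖)
      (g := fun n => ‖testCoeff ψ (-n)‖) (by simpa using ha) (by simpa using hbn)).mul_right B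
    refine Summable.of_norm_bounded h fun p => ?_
    rw [norm_mul, norm_mul]
    calc _ ≤ ‖testCoeff φ p.1‖ * B * ‖testCoeff ψ (-p.2)‖ := by gcongr; exact hS _
      _ = _ := by ring
  have hsum' : Summable fun p : ℤ × ℤ => testCoeff φ p.1 * S p.2 * testCoeff ψ (-p.2 - p.1) := by
    refine (intShear.symm.summable_iff.2 hsum).congr fun p => ?_
    simp only [Function.comp, intShear, Equiv.coe_fn_symm_mk]
    congr 2
    · congr 1; ring
    · ring
  have e1 : seqAct (seqConv (testCoeff φ) S) ψ =
      ∑' m, ∑' k, testCoeff φ k * S (m - k) * testCoeff ψ (-m) := by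
    simp only [seqAct, seqConv, tsum_mul_right]
  have e2 : seqAct S (fun θ => φ θ * ψ θ) =
      ∑' l, ∑' k, testCoeff φ k * S l * testCoeff ψ (-l - k) := by
    simp only [seqAct, testCoeff_mul hφ hψ, seqConv, ← tsum_mul_left]
    congr 1; ext l; congr 1; ext k; ring
  rw [e1, e2, Summable.tsum_comm (f := fun k m => testCoeff φ k * S (m - k) * testCoeff ψ (-m)) hsum,
    Summable.tsum_comm (f := fun k l => testCoeff φ k * S l * testCoeff ψ (-l - k)) hsum']
  congr 1; ext k
  rw [← (Equiv.addRight k).tsum_eq]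
  simp only [Equiv.coe_addRight]
  congr 1; ext l
  congr 2
  · congr 1; ring
  · ring

lemma testCoeff_zero_fun (n : ℤ) : testCoeff (fun _ => 0) n = 0 := by
  simp [testCoeff]

lemma seqAct_zero (S : ℤ → ℂ) : seqAct S (fun _ => 0) = 0 := by
  simp [seqAct, testCoeff_zero_fun]

lemma summable_weighted_testCoeff_neg {φ : ℝ → ℂ} (hφ : PeriodicSmooth φ) :
    Summable fun n : ℤ => (1 + |(n : ℝ)|) * ‖testCoeff φ (-n)‖ := by
  have h := (Equiv.neg ℤ).summable_iff.2 (summable_weighted_testCoeff hφ)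
  simpa [Function.comp_def] using h

lemma seqAct_finset_sum {ι : Type*} (s : Finset ι) (S : ι → ℤ → ℂ) (B : ι → ℝ)
    (hS : ∀ i ∈ s, ∀ n, ‖S i n‖ ≤ B i) {φ : ℝ → ℂ} (hφ : PeriodicSmooth φ) :
    seqAct (fun n => ∑ i ∈ s, S i n) φ = ∑ i ∈ s, seqAct (S i) φ := by
  have hb : Summable fun n : ℤ => ‖testCoeff φ (-n)‖ :=
    (Equiv.neg ℤ).summable_iff.2 (summable_norm_testCoeff hφ)
  simp only [seqAct, Finset.sum_mul]
  refine Summable.tsum_finsetSum fun i hi => ?_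
  refine Summable.of_norm_bounded (hb.mul_left (B i)) fun n => ?_
  rw [norm_mul]
  gcongr
  exact hS i hi n

lemma testCoeff_add {φ ψ : ℝ → ℂ} (hφ : Continuous φ) (hψ : Continuous ψ) (n : ℤ) :
    testCoeff (fun θ => φ θ + ψ θ) n = testCoeff φ n + testCoeff ψ n := by
  simp only [testCoeff, add_mul]
  rw [intervalIntegral.integral_add (Continuous.intervalIntegrable (by fun_prop) _ _)
    (Continuous.intervalIntegrable (by fun_prop) _ _), mul_add]

lemma testCoeff_sub {φ ψ : ℝ → ℂ} (hφ : Continuous φ) (hψ : Continuous ψ) (n : ℤ) :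
    testCoeff (fun θ => φ θ - ψ θ) n = testCoeff φ n - testCoeff ψ n := by
  simp only [testCoeff, sub_mul]
  rw [intervalIntegral.integral_sub (Continuous.intervalIntegrable (by fun_prop) _ _)
    (Continuous.intervalIntegrable (by fun_prop) _ _), mul_sub]

lemma testCoeff_const_mul (c : ℂ) (φ : ℝ → ℂ) (n : ℤ) :
    testCoeff (fun θ => c * φ θ) n = c * testCoeff φ n := by
  simp only [testCoeff, mul_assoc c]
  rw [intervalIntegral.integral_const_mul]
  ring

lemma contDiff_exp_mul_I : ContDiff ℝ (⊤ : ℕ∞) fun θ : ℝ => Complex.exp ((θ : ℂ) * Complex.I) :=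
  (Complex.ofRealCLM.contDiff.mul contDiff_const).cexp

lemma exp_add_two_pi_mul_I (θ : ℝ) :
    Complex.exp (((θ + 2 * Real.pi : ℝ) : ℂ) * Complex.I) = Complex.exp ((θ : ℂ) * Complex.I) := by
  simpa using exp_int_mul_add_two_pi 1 θ

lemma norm_exp_mul_I_sub_sq (θ : ℝ) (ζ : ℂ) :
    ‖Complex.exp ((θ : ℂ) * Complex.I) - ζ‖ ^ 2 =
      (Real.cos θ - ζ.re) ^ 2 + (Real.sin θ - ζ.im) ^ 2 := by
  rw [← Complex.normSq_eq_norm_sq, Complex.normSq_apply, Complex.sub_re, Complex.sub_im,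
    Complex.exp_ofReal_mul_I_re, Complex.exp_ofReal_mul_I_im]
  ring

/-- A smooth function of `‖e^{iθ} - ζ‖²` is a test function. -/
lemma periodicSmooth_comp_norm_sq {g : ℝ → ℝ} (hg : ContDiff ℝ (⊤ : ℕ∞) g) (ζ : ℂ) :
    PeriodicSmooth fun θ => (g (‖Complex.exp ((θ : ℂ) * Complex.I) - ζ‖ ^ 2) : ℂ) := by
  refine ⟨?_, fun θ => by simp only [exp_add_two_pi_mul_I]⟩
  simp only [norm_exp_mul_I_sub_sq]
  refine Complex.ofRealCLM.contDiff.comp (hg.comp ?_)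
  exact ((Real.contDiff_cos.sub contDiff_const).pow 2).add
    ((Real.contDiff_sin.sub contDiff_const).pow 2)

lemma one_sub_mul_exp_ne_zero {r : ℝ} (h0 : 0 ≤ r) (h1 : r < 1) {z : ℂ} (hz : ‖z‖ ≤ 1) :
    1 - (r : ℂ) * z ≠ 0 := by
  intro h
  have h2 : ‖(r : ℂ) * z‖ = 1 := by rw [← sub_eq_zero.1 h, norm_one]
  rw [norm_mul, Complex.norm_real, Real.norm_of_nonneg h0] at h2
  nlinarith [norm_nonneg z]

/-- The analytic function `2rz / (1 - rz)`, whose real part on the circle is the Poisson kernel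
minus one. -/
def poissonExponent (r : ℝ) (z : ℂ) : ℂ := 2 * (r * z) / (1 - r * z)

lemma periodicSmooth_poissonExponent {r : ℝ} (h0 : 0 ≤ r) (h1 : r < 1) :
    PeriodicSmooth fun θ => poissonExponent r (Complex.exp ((θ : ℂ) * Complex.I)) := by
  refine ⟨?_, fun θ => by simp only [exp_add_two_pi_mul_I]⟩
  have h : ContDiff ℝ (⊤ : ℕ∞) fun θ : ℝ => (r : ℂ) * Complex.exp ((θ : ℂ) * Complex.I) :=
    contDiff_const.mul contDiff_exp_mul_I
  simp only [poissonExponent, div_eq_mul_inv]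
  exact (contDiff_const.mul h).mul ((contDiff_const.sub h).inv fun θ =>
    one_sub_mul_exp_ne_zero h0 h1 (Complex.norm_exp_ofReal_mul_I θ).le)

lemma poissonExponent_re_le {ε : ℝ} (hε : 0 < ε) (hε1 : ε ≤ 1) {z : ℂ} (hz : ‖z‖ = 1)
    (h : ε / 2 ≤ ‖z - 1‖) : (poissonExponent (1 - ε ^ 2 / 64) z).re ≤ -(1 / 2) := by
  set r : ℝ := 1 - ε ^ 2 / 64 with hr
  have hr0 : 0 ≤ r := by nlinarith
  have hr1 : r < 1 := by nlinarith [pow_pos hε 2]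
  set D : ℂ := 1 - r * z with hD
  have hD0 : D ≠ 0 := one_sub_mul_exp_ne_zero hr0 hr1 hz.le
  have hDn : ε / 4 ≤ ‖D‖ := by
    have h1 : ‖z - 1‖ ≤ ‖D‖ + (1 - r) := by
      have h2 : z - 1 = -D + ((1 - r : ℝ) : ℂ) * z := by rw [hD]; push_cast; ring
      rw [h2]
      refine (norm_add_le _ _).trans ?_
      rw [norm_neg, norm_mul, hz, mul_one, Complex.norm_real, Real.norm_of_nonneg (by linarith)]
    nlinarith
  have hns : Complex.normSq D = ‖D‖ ^ 2 := Complex.normSq_eq_norm_sq D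
  have hns0 : 0 < Complex.normSq D := Complex.normSq_pos.2 hD0
  have hw : Complex.normSq (r * z) = r ^ 2 := by
    rw [Complex.normSq_eq_norm_sq, norm_mul, hz, mul_one, Complex.norm_real, Real.norm_eq_abs, sq_abs]
  have he : poissonExponent r z = 2 / D - 2 := by
    rw [poissonExponent, ← hD]
    field_simp
    rw [hD]
    ring
  have hre : (2 / D).re = 2 * D.re / Complex.normSq D := by
    simp [Complex.div_re]
  have key : 2 * D.re = Complex.normSq D + 1 - r ^ 2 := by
    rw [← hw]
    simp only [hD, Complex.normSq_apply, Complex.sub_re, Complex.sub_im, Complex.one_re,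
      Complex.one_im]
    ring
  rw [he, Complex.sub_re, hre]
  have : 2 * D.re / Complex.normSq D ≤ 3 / 2 := by
    rw [div_le_iff₀ hns0, key, hns]
    nlinarith
  simp
  linarith

lemma testCoeff_exp_poissonExponent {r : ℝ} (h0 : 0 ≤ r) (h1 : r < 1) (a : ℝ) (j : ℕ) :
    testCoeff (fun θ => Complex.exp (a * poissonExponent r (Complex.exp ((θ : ℂ) * Complex.I))))
      (-(j : ℤ)) = if j = 0 then 1 else 0 := by
  set f : ℂ → ℂ := fun z => Complex.exp (a * poissonExponent r z) * z ^ j with hf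
  have hd : DiffContOnCl ℂ f (ball 0 |1|) := by
    refine DifferentiableOn.diffContOnCl_ball (U := closedBall 0 1) (fun z hz => ?_) (by simp)
    have hz1 : ‖z‖ ≤ 1 := by simpa using hz
    have hne := one_sub_mul_exp_ne_zero h0 h1 hz1
    simp only [hf, poissonExponent]
    refine DifferentiableAt.differentiableWithinAt ?_
    fun_prop (disch := assumption)
  have h := hd.circleAverage
  rw [Real.circleAverage_def] at h
  rw [testCoeff]
  have hint : ∀ θ : ℝ, Complex.exp (a * poissonExponent r (Complex.exp ((θ : ℂ) * Complex.I))) *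
      Complex.exp (-((-(j : ℤ) : ℤ) : ℂ) * (θ : ℂ) * Complex.I) = f (circleMap 0 1 θ) := by
    intro θ
    simp only [hf, circleMap, zero_add, ofReal_one, one_mul]
    rw [← Complex.exp_nat_mul]
    congr 2
    push_cast
    ring
  simp only [hint]
  have h2 : (1 / (2 * Real.pi) : ℂ) * ∫ θ in (0:ℝ)..(2 * Real.pi), f (circleMap 0 1 θ) = f 0 := by
    rw [← h, Complex.real_smul]
    push_cast
    rw [one_div]
  rw [h2, hf]
  simp [poissonExponent, zero_pow_eq]

/-- Test functions vanishing at all points of the circle at distance less than `d` from `1`. -/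
def VanishNearOne (d : ℝ) (u : ℝ → ℂ) : Prop :=
  PeriodicSmooth u ∧ ∀ θ : ℝ, ‖Complex.exp ((θ : ℂ) * Complex.I) - 1‖ < d → u θ = 0

lemma VanishNearOne.mul {d : ℝ} {u g : ℝ → ℂ} (hg : PeriodicSmooth g) (hu : VanishNearOne d u) :
    VanishNearOne d fun θ => g θ * u θ :=
  ⟨hg.mul hu.1, fun θ hθ => by simp only [hu.2 θ hθ, mul_zero]⟩

lemma VanishNearOne.deriv {d : ℝ} {u : ℝ → ℂ} (hu : VanishNearOne d u) :
    VanishNearOne d (deriv u) := by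
  refine ⟨hu.1.deriv, fun θ hθ => ?_⟩
  have hopen : IsOpen {t : ℝ | ‖Complex.exp ((t : ℂ) * Complex.I) - 1‖ < d} :=
    isOpen_lt (by fun_prop) continuous_const
  have h : u =ᶠ[nhds θ] fun _ => 0 :=
    (hopen.eventually_mem hθ).mono fun t ht => hu.2 t ht
  rw [h.deriv_eq]
  simp

lemma PeriodicSmooth.cexp_mul {G : ℝ → ℂ} (hG : PeriodicSmooth G) (a : ℝ) :
    PeriodicSmooth fun θ => Complex.exp (a * G θ) :=
  ⟨(contDiff_const.mul hG.1).cexp, fun θ => by simp only [hG.2]⟩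

lemma exists_testCoeff_cexp_mul_decay {G : ℝ → ℂ} (hG : PeriodicSmooth G) {d b : ℝ}
    (hGb : ∀ θ : ℝ, d ≤ ‖Complex.exp ((θ : ℂ) * Complex.I) - 1‖ → (G θ).re ≤ -b) (j : ℕ)
    {u : ℝ → ℂ} (hu : VanishNearOne d u) :
    ∃ C, ∀ a : ℝ, 0 ≤ a → ∀ n : ℤ,
      (1 + |(n : ℝ)|) ^ j * ‖testCoeff (fun θ => Complex.exp (a * G θ) * u θ) n‖ ≤
        C * (1 + a) ^ j * Real.exp (-(b * a)) := by
  induction j generalizing u with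
  | zero =>
    obtain ⟨C, hC⟩ := hu.1.exists_bound
    have hC0 : 0 ≤ C := (norm_nonneg _).trans (hC 0)
    refine ⟨C, fun a ha n => ?_⟩
    rw [pow_zero, one_mul, pow_zero, mul_one]
    refine norm_testCoeff_le (fun θ => ?_) n
    rw [norm_mul, Complex.norm_exp]
    rcases lt_or_ge ‖Complex.exp ((θ : ℂ) * Complex.I) - 1‖ d with h | h
    · rw [hu.2 θ h, norm_zero, mul_zero]
      positivity
    · rw [mul_comm C, Complex.re_ofReal_mul]
      have := hGb θ h
      gcongr
      · nlinarith
      · exact hC θ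
  | succ j ih =>
    obtain ⟨C, hC⟩ := ih hu
    obtain ⟨C₁, hC₁⟩ := ih (hu.mul hG.deriv)
    obtain ⟨C₂, hC₂⟩ := ih hu.deriv
    refine ⟨C + C₁ + C₂, fun a ha n => ?_⟩
    set w : ℝ → ℂ := fun θ => Complex.exp (a * G θ) * u θ with hw
    have hws : PeriodicSmooth w := (hG.cexp_mul a).mul hu.1
    have hder : deriv w = fun θ => a * (Complex.exp (a * G θ) * (_root_.deriv G θ * u θ)) +
        Complex.exp (a * G θ) * _root_.deriv u θ := by
      funext θ
      have h := ((((hG.hasDerivAt θ).const_mul (a : ℂ)).cexp).mul (hu.1.hasDerivAt θ)).deriv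
      refine Eq.trans h ?_
      ring
    have h1 := testCoeff_deriv hws n
    have c1 : Continuous fun θ => Complex.exp (a * G θ) := (hG.cexp_mul a).continuous
    have c2 := hG.deriv.continuous
    have c3 := hu.1.continuous
    have c4 := hu.1.deriv.continuous
    rw [hder, testCoeff_add (by fun_prop) (by fun_prop), testCoeff_const_mul] at h1
    have h2 : |(n : ℝ)| * ‖testCoeff w n‖ ≤
        a * ‖testCoeff (fun θ => Complex.exp (a * G θ) * (_root_.deriv G θ * u θ)) n‖ +
          ‖testCoeff (fun θ => Complex.exp (a * G θ) * _root_.deriv u θ) n‖ := by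
      have h3 : ‖(n : ℂ) * Complex.I * testCoeff w n‖ = |(n : ℝ)| * ‖testCoeff w n‖ := by
        rw [norm_mul, norm_mul, Complex.norm_I, mul_one, Complex.norm_intCast]
      rw [← h3, ← h1]
      refine (norm_add_le _ _).trans ?_
      rw [norm_mul, Complex.norm_real, Real.norm_of_nonneg ha]
    have i0 := hC a ha n
    have i1 := hC₁ a ha n
    have i2 := hC₂ a ha n
    set X := (1 + |(n : ℝ)|) ^ j with hX
    have hX0 : 0 ≤ X := by positivity
    set Y := (1 + a) ^ j * Real.exp (-(b * a)) with hY
    have hC0 : 0 ≤ C * Y := by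
      rw [hY, ← mul_assoc]; exact le_trans (by positivity) i0
    have hC2 : 0 ≤ C₂ * Y := by
      rw [hY, ← mul_assoc]; exact le_trans (by positivity) i2
    have hC1 : 0 ≤ C₁ * Y := by
      rw [hY, ← mul_assoc]; exact le_trans (by positivity) i1
    generalize ‖testCoeff (fun θ => Complex.exp (a * G θ) * (_root_.deriv G θ * u θ)) n‖ = P
      at h2 i1
    generalize ‖testCoeff (fun θ => Complex.exp (a * G θ) * _root_.deriv u θ) n‖ = Q at h2 i2
    calc _ = X * ‖testCoeff w n‖ + X * (|(n : ℝ)| * ‖testCoeff w n‖) := by rw [hX]; ring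
      _ ≤ X * ‖testCoeff w n‖ + X * (a * P + Q) := by gcongr
      _ = X * ‖testCoeff w n‖ + (a * (X * P) + X * Q) := by ring
      _ ≤ C * (1 + a) ^ j * Real.exp (-(b * a)) + (a * (C₁ * (1 + a) ^ j * Real.exp (-(b * a))) +
          C₂ * (1 + a) ^ j * Real.exp (-(b * a))) := by gcongr
      _ = C * Y + (a * (C₁ * Y) + C₂ * Y) := by rw [hY]; ring
      _ ≤ (C * Y + C₁ * Y + C₂ * Y) * (1 + a) := by nlinarith
      _ = _ := by rw [hY]; ring

/-- A test function concentrated near `1` whose Fourier coefficients of nonpositive index are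
close to those of the constant `1`. -/
lemma exists_concentrated_kernel {ε δ : ℝ} (hε : 0 < ε) (hε1 : ε ≤ 1) (hδ : 0 < δ) :
    ∃ h : ℝ → ℂ, PeriodicSmooth h ∧
      (∀ θ : ℝ, ε ≤ ‖Complex.exp ((θ : ℂ) * Complex.I) - 1‖ → h θ = 0) ∧
      ∃ b : ℤ → ℝ, Summable b ∧ ∑' k, b k ≤ δ ∧ (∀ k, 0 ≤ b k) ∧
        ∀ k : ℤ, k ≤ 0 → ‖testCoeff h k - if k = 0 then 1 else 0‖ ≤ b k := by
  set r : ℝ := 1 - ε ^ 2 / 64 with hr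
  have hr0 : 0 ≤ r := by nlinarith
  have hr1 : r < 1 := by nlinarith [pow_pos hε 2]
  set G : ℝ → ℂ := fun θ => poissonExponent r (Complex.exp ((θ : ℂ) * Complex.I)) with hGdef
  have hG : PeriodicSmooth G := periodicSmooth_poissonExponent hr0 hr1
  have hGb : ∀ θ : ℝ, ε / 2 ≤ ‖Complex.exp ((θ : ℂ) * Complex.I) - 1‖ → (G θ).re ≤ -(1 / 2) :=
    fun θ hθ => poissonExponent_re_le hε hε1 (Complex.norm_exp_ofReal_mul_I θ) hθ
  set g : ℝ → ℝ := fun x => Real.smoothTransition ((x - ε ^ 2 / 4) / (3 * ε ^ 2 / 4)) with hg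
  have hgs : ContDiff ℝ (⊤ : ℕ∞) g :=
    Real.smoothTransition.contDiff.comp ((contDiff_id.sub contDiff_const).div_const _)
  set u : ℝ → ℂ := fun θ => (g (‖Complex.exp ((θ : ℂ) * Complex.I) - 1‖ ^ 2) : ℂ) with hu
  have hus : PeriodicSmooth u := periodicSmooth_comp_norm_sq hgs 1
  have hu0 : VanishNearOne (ε / 2) u := by
    refine ⟨hus, fun θ hθ => ?_⟩
    simp only [hu, hg]
    rw [Real.smoothTransition.zero_of_nonpos, ofReal_zero]
    refine div_nonpos_of_nonpos_of_nonneg ?_ (by positivity)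
    nlinarith [norm_nonneg (Complex.exp ((θ : ℂ) * Complex.I) - 1)]
  have hu1 : ∀ θ : ℝ, ε ≤ ‖Complex.exp ((θ : ℂ) * Complex.I) - 1‖ → u θ = 1 := by
    intro θ hθ
    simp only [hu, hg]
    rw [Real.smoothTransition.one_of_one_le, ofReal_one]
    rw [le_div_iff₀ (by positivity)]
    nlinarith
  obtain ⟨C, hC⟩ := exists_testCoeff_cexp_mul_decay hG hGb 2 hu0
  set M : ℝ := ∑' n : ℤ, ((1 + |(n : ℝ)|) ^ 2)⁻¹ with hM
  have hlim : Tendsto (fun a : ℝ => C * (1 + a) ^ 2 * Real.exp (-(1 / 2 * a)) * M) atTop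
      (nhds 0) := by
    have h1 : Tendsto (fun a : ℝ => (1 + a) / 2) atTop atTop :=
      (tendsto_atTop_add_const_left _ 1 tendsto_id).atTop_div_const two_pos
    have h2 := ((Real.tendsto_pow_mul_exp_neg_atTop_nhds_zero 2).comp h1).const_mul
      (4 * Real.exp (1 / 2) * C * M)
    rw [mul_zero] at h2
    refine h2.congr fun a => ?_
    have h3 : Real.exp (-(1 / 2 * a)) = Real.exp (1 / 2) * Real.exp (-((1 + a) / 2)) := by
      rw [← Real.exp_add]
      ring_nf
    simp only [Function.comp_apply, h3]
    ring
  obtain ⟨a, ha, haδ⟩ := ((eventually_ge_atTop (0 : ℝ)).and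
    (hlim.eventually (ge_mem_nhds hδ))).exists
  set c : ℝ := C * (1 + a) ^ 2 * Real.exp (-(1 / 2 * a)) with hc
  have hc0 : 0 ≤ c := le_trans (by positivity) (hC a ha 0)
  refine ⟨fun θ => Complex.exp (a * G θ) - Complex.exp (a * G θ) * u θ,
    (hG.cexp_mul a).sub ((hG.cexp_mul a).mul hus), fun θ hθ => ?_,
    fun n => c * ((1 + |(n : ℝ)|) ^ 2)⁻¹, summable_inv_one_add_abs_sq.mul_left c, ?_,
    fun k => by positivity, fun k hk => ?_⟩
  · simp only [hu1 θ hθ, mul_one, sub_self]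
  · rw [tsum_mul_left]
    exact haδ
  · obtain ⟨j, rfl⟩ : ∃ j : ℕ, k = -(j : ℤ) := ⟨(-k).toNat, by omega⟩
    rw [testCoeff_sub (hG.cexp_mul a).continuous ((hG.cexp_mul a).mul hus).continuous,
      testCoeff_exp_poissonExponent hr0 hr1 a j]
    have : ((-(j : ℤ) = 0)) ↔ j = 0 := by omega
    simp only [this]
    rw [sub_right_comm, sub_self, zero_sub, norm_neg, ← div_eq_mul_inv,
      le_div_iff₀ (by positivity), mul_comm]
    exact hC a ha _

lemma PeriodicSmooth.dilate {h : ℝ → ℂ} (hh : PeriodicSmooth h) (n : ℕ) (α : ℝ) :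
    PeriodicSmooth fun θ => h (n * θ - α) := by
  refine ⟨hh.1.comp ((contDiff_const.mul contDiff_id).sub contDiff_const), fun θ => ?_⟩
  have h1 := hh.periodic.nat_mul n (n * θ - α)
  have h2 : (n : ℝ) * (θ + 2 * Real.pi) - α = n * θ - α + n * (2 * Real.pi) := by ring
  simp only [h2, h1]

lemma exp_natMul_sub_mul_I (n : ℕ) (θ α : ℝ) :
    Complex.exp (((n * θ - α : ℝ) : ℂ) * Complex.I) =
      Complex.exp ((θ : ℂ) * Complex.I) ^ n * (Complex.exp ((α : ℂ) * Complex.I))⁻¹ := by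
  rw [← Complex.exp_nat_mul, ← Complex.exp_neg, ← Complex.exp_add]
  congr 1
  push_cast
  ring

lemma seqConv_dilate {h : ℝ → ℂ} (hh : PeriodicSmooth h) {n : ℕ} (hn : n ≠ 0) (α : ℝ)
    (T : ℤ → ℂ) (m : ℤ) :
    seqConv (testCoeff fun θ => h (n * θ - α)) T m =
      ∑' k : ℤ, testCoeff h k * Complex.exp (-(k : ℂ) * (α : ℂ) * Complex.I) * T (m - n * k) := by
  set g : ℤ → ℤ := fun k => n * k with hg
  have hginj : Function.Injective g := mul_right_injective₀ (Nat.cast_ne_zero.2 hn)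
  set a : ℤ → ℂ := fun k => testCoeff h k * Complex.exp (-(k : ℂ) * (α : ℂ) * Complex.I) with ha
  set A : ℤ → ℂ := Function.extend g a 0 with hA
  have hAg : ∀ k, A (g k) = a k := fun k => hginj.extend_apply a 0 k
  have hA0 : ∀ l, l ∉ Set.range g → A l = 0 := fun l hl => by
    rw [hA, Function.extend_apply' _ _ _ hl, Pi.zero_apply]
  have hAs : Summable fun l => ‖A l‖ := by
    refine (hginj.summable_iff fun l hl => by rw [hA0 l hl, norm_zero]).1 ?_
    refine (summable_norm_testCoeff hh).congr fun k => ?_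
    simp only [Function.comp_apply, hAg, ha, norm_mul, norm_exp_neg_int_mul, mul_one]
  have hcoeff : testCoeff (fun θ => h (n * θ - α)) = A := by
    funext l
    refine testCoeff_eq_of_hasSum hAs (fun θ => ?_) l
    refine (hginj.hasSum_iff fun l hl => by rw [hA0 l hl, zero_mul]).1 ?_
    have h1 := hasSum_testCoeff hh (n * θ - α)
    have h2 : (fun k : ℤ => testCoeff h k *
        Complex.exp ((k : ℂ) * ((n * θ - α : ℝ) : ℂ) * Complex.I)) =
        (fun l : ℤ => A l * Complex.exp ((l : ℂ) * (θ : ℂ) * Complex.I)) ∘ g := by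
      funext k
      simp only [Function.comp_apply, hAg, ha]
      rw [mul_assoc (testCoeff h k), ← Complex.exp_add]
      congr 2
      simp only [hg]
      push_cast
      ring
    rw [← h2]
    exact h1
  rw [hcoeff, seqConv, ← hginj.tsum_eq]
  · exact tsum_congr fun k => by rw [hAg]
  · intro l hl
    by_contra hl2
    exact hl (by simp only [hA0 l hl2, zero_mul])

/-- Multiplication by a dilate of a function whose coefficients of nonpositive index are close to
those of `1` changes a bounded sequence only a little to the left of the dilation factor. -/
lemma norm_seqConv_dilate_sub_le {h : ℝ → ℂ} (hh : PeriodicSmooth h) {b : ℤ → ℝ}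
    (hb : Summable b) (hb0 : ∀ k, 0 ≤ b k)
    (hbh : ∀ k : ℤ, k ≤ 0 → ‖testCoeff h k - if k = 0 then 1 else 0‖ ≤ b k)
    {n : ℕ} (hn : n ≠ 0) (α : ℝ) {T : ℤ → ℂ} {B η : ℝ} (hB : ∀ l, ‖T l‖ ≤ B) {m : ℤ}
    (hη : ∀ l : ℤ, l ≤ m - n → ‖T l‖ ≤ η) :
    ‖seqConv (testCoeff fun θ => h (n * θ - α)) T m - T m‖ ≤
      (∑' k, b k) * B + (∑' k, ‖testCoeff h k‖) * η := by
  have hs := summable_norm_testCoeff hh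
  have hB0 : 0 ≤ B := (norm_nonneg _).trans (hB 0)
  have hη0 : 0 ≤ η := (norm_nonneg _).trans (hη _ le_rfl)
  set E : ℤ → ℂ := fun k => Complex.exp (-(k : ℂ) * (α : ℂ) * Complex.I) with hE
  have hEn : ∀ k, ‖E k‖ = 1 := fun k => norm_exp_neg_int_mul k α
  have hsum1 : Summable fun k : ℤ => testCoeff h k * E k * T (m - n * k) := by
    refine .of_norm ((hs.mul_right B).of_nonneg_of_le (fun k => norm_nonneg _) fun k => ?_)
    rw [norm_mul, norm_mul, hEn, mul_one]
    gcongr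
    exact hB _
  have h0 : HasSum (fun k : ℤ => (if k = 0 then 1 else 0) * E k * T (m - n * k)) (T m) := by
    have h1 := hasSum_single (f := fun k : ℤ => (if k = 0 then 1 else 0) * E k * T (m - n * k)) 0
      (fun k hk => by simp [hk])
    simpa [hE] using h1
  have hsub := hsum1.hasSum.sub h0
  rw [seqConv_dilate hh hn, ← hsub.tsum_eq]
  have hbd := (hb.mul_right B).add (hs.mul_right η)
  have hle : ∀ k : ℤ, ‖testCoeff h k * E k * T (m - n * k) -
      (if k = 0 then 1 else 0) * E k * T (m - n * k)‖ ≤ b k * B + ‖testCoeff h k‖ * η := by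
    intro k
    rw [← sub_mul, ← sub_mul, norm_mul, norm_mul, hEn, mul_one]
    rcases le_or_gt k 0 with hk | hk
    · have : ‖testCoeff h k - if k = 0 then 1 else 0‖ * ‖T (m - n * k)‖ ≤ b k * B :=
        mul_le_mul (hbh k hk) (hB _) (norm_nonneg _) (hb0 k)
      have h3 : 0 ≤ ‖testCoeff h k‖ * η := by positivity
      linarith
    · rw [if_neg hk.ne', sub_zero]
      have h4 : ‖T (m - n * k)‖ ≤ η := hη _ (by nlinarith)
      have h5 : ‖testCoeff h k‖ * ‖T (m - n * k)‖ ≤ ‖testCoeff h k‖ * η := by gcongr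
      have h6 := mul_nonneg (hb0 k) hB0
      linarith
  refine (tsum_of_norm_bounded hbd.hasSum hle).trans_eq ?_
  rw [(hb.mul_right B).tsum_add (hs.mul_right η), tsum_mul_right, tsum_mul_right]

/-- A smooth partition of unity on the circle subordinate to a finite cover by balls. -/
lemma exists_smooth_partition {ι : Type*} (s : Finset ι) (ζ : ι → ℂ) {ρ : ℝ} (hρ : 0 < ρ)
    (hcov : ∀ z : ℂ, ‖z‖ = 1 → ∃ p ∈ s, ‖z - ζ p‖ < ρ) :
    ∃ τ : ι → ℝ → ℂ, (∀ p, PeriodicSmooth (τ p)) ∧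
      (∀ p, ∀ θ : ℝ, ρ ≤ ‖Complex.exp ((θ : ℂ) * Complex.I) - ζ p‖ → τ p θ = 0) ∧
      ∀ θ, ∑ p ∈ s, τ p θ = 1 := by
  set b : ι → ℝ → ℝ := fun p θ =>
    expNegInvGlue (ρ ^ 2 - ‖Complex.exp ((θ : ℂ) * Complex.I) - ζ p‖ ^ 2) with hb
  have hbs : ∀ p, PeriodicSmooth fun θ => (b p θ : ℂ) := fun p =>
    periodicSmooth_comp_norm_sq (g := fun x => expNegInvGlue (ρ ^ 2 - x))
      (expNegInvGlue.contDiff.comp (contDiff_const.sub contDiff_id)) (ζ p)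
  have hpos : ∀ θ, 0 < ∑ p ∈ s, b p θ := by
    intro θ
    obtain ⟨p, hp, hlt⟩ := hcov _ (Complex.norm_exp_ofReal_mul_I θ)
    refine Finset.sum_pos' (fun q _ => expNegInvGlue.nonneg _) ⟨p, hp, ?_⟩
    refine expNegInvGlue.pos_of_pos ?_
    nlinarith [norm_nonneg (Complex.exp ((θ : ℂ) * Complex.I) - ζ p)]
  have hsum : PeriodicSmooth fun θ => (∑ p ∈ s, (b p θ : ℂ)) :=
    ⟨ContDiff.sum fun p _ => (hbs p).1, fun θ => Finset.sum_congr rfl fun p _ => (hbs p).2 θ⟩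
  have hne : ∀ θ, (∑ p ∈ s, (b p θ : ℂ)) ≠ 0 := by
    intro θ
    rw [← Complex.ofReal_sum]
    exact_mod_cast (hpos θ).ne'
  refine ⟨fun p θ => b p θ * (∑ q ∈ s, (b q θ : ℂ))⁻¹, fun p => (hbs p).mul
    ⟨hsum.1.inv hne, fun θ => congrArg _ (hsum.2 θ)⟩, fun p θ hθ => ?_, fun θ => ?_⟩
  · have : b p θ = 0 := expNegInvGlue.zero_of_nonpos (by nlinarith)
    simp only [this, ofReal_zero, zero_mul]
  · rw [← Finset.sum_mul, mul_inv_cancel₀ (hne θ)]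

/-- The distribution with Fourier coefficients `S` kills every test function supported in `U`. -/
def VanishesOn (S : ℤ → ℂ) (U : Set ℂ) : Prop :=
  ∀ ψ : ℝ → ℂ, PeriodicSmooth ψ →
    (∀ θ : ℝ, Complex.exp ((θ : ℂ) * Complex.I) ∉ U → ψ θ = 0) → seqAct S ψ = 0

lemma VanishesOn.seqConv {S : ℤ → ℂ} {U : Set ℂ} (h : VanishesOn S U) {φ : ℝ → ℂ}
    (hφ : PeriodicSmooth φ) {B : ℝ} (hB : ∀ n, ‖S n‖ ≤ B) :
    VanishesOn (seqConv (testCoeff φ) S) U := by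
  intro ψ hψ h0
  rw [seqAct_seqConv hφ hψ hB]
  exact h _ (hφ.mul hψ) fun θ hθ => by simp only [h0 θ hθ, mul_zero]

lemma VanishesOn.finset_sum {ι : Type*} {s : Finset ι} {S : ι → ℤ → ℂ} {U : Set ℂ}
    (h : ∀ i ∈ s, VanishesOn (S i) U) {B : ι → ℝ} (hB : ∀ i ∈ s, ∀ n, ‖S i n‖ ≤ B i) :
    VanishesOn (fun n => ∑ i ∈ s, S i n) U := by
  intro ψ hψ h0
  rw [seqAct_finset_sum s S B hB hψ]
  exact Finset.sum_eq_zero fun i hi => h i hi ψ hψ h0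

lemma sum_seqConv_partition {ι : Type*} {s : Finset ι} {τ : ι → ℝ → ℂ}
    (hτ : ∀ p, PeriodicSmooth (τ p)) (hτ1 : ∀ θ, ∑ p ∈ s, τ p θ = 1) {S : ℤ → ℂ} {B : ℝ}
    (hB : ∀ n, ‖S n‖ ≤ B) (m : ℤ) :
    ∑ p ∈ s, seqConv (testCoeff (τ p)) S m = S m := by
  have hsum : ∀ k, ∑ p ∈ s, testCoeff (τ p) k = if k = 0 then 1 else 0 := by
    intro k
    have h1 : testCoeff (fun θ => ∑ p ∈ s, τ p θ) k = ∑ p ∈ s, testCoeff (τ p) k := by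
      simp only [testCoeff, Finset.sum_mul]
      rw [intervalIntegral.integral_finsetSum, Finset.mul_sum]
      intro p _
      have := (hτ p).continuous
      exact Continuous.intervalIntegrable (by fun_prop) _ _
    rw [← h1]
    refine testCoeff_eq_of_hasSum (a := fun k => if k = 0 then 1 else 0) ?_ (fun θ => ?_) k
    · exact summable_of_ne_finset_zero (s := {0}) fun k hk => by
        simp only [Finset.mem_singleton] at hk
        simp [hk]
    · have h2 := hasSum_single (f := fun k : ℤ => (if k = 0 then (1 : ℂ) else 0) *
        Complex.exp ((k : ℂ) * (θ : ℂ) * Complex.I)) 0 (fun k hk => by simp [hk])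
      simpa [hτ1] using h2
  have hterm : ∀ p ∈ s, Summable fun k => testCoeff (τ p) k * S (m - k) := fun p _ =>
    (summable_seqConv_term (summable_norm_testCoeff (hτ p)) hB m).of_norm
  simp only [seqConv]
  rw [← Summable.tsum_finsetSum hterm, tsum_eq_single 0]
  · rw [← Finset.sum_mul, hsum, if_pos rfl, one_mul, sub_zero]
  · intro k hk
    rw [← Finset.sum_mul, hsum, if_neg hk, zero_mul]

lemma exists_uniform_bound {ι : Type*} (s : Finset ι) {T : ι → ℤ → ℂ}
    (hT : ∀ p, Tendsto (T p) cofinite (nhds 0)) : ∃ B, 0 ≤ B ∧ ∀ p ∈ s, ∀ l, ‖T p l‖ ≤ B := by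
  choose B hB0 hB using fun p => exists_bound_of_tendsto_cofinite (hT p)
  exact ⟨∑ p ∈ s, B p, Finset.sum_nonneg fun p _ => hB0 p, fun p hp l =>
    (hB p l).trans (Finset.single_le_sum (f := B) (fun q _ => hB0 q) hp)⟩

lemma exists_left_bound {ι : Type*} (s : Finset ι) {T : ι → ℤ → ℂ}
    (hT : ∀ p, Tendsto (T p) cofinite (nhds 0)) {η : ℝ} (hη : 0 < η) :
    ∃ L : ℤ, ∀ p ∈ s, ∀ l ≤ L, ‖T p l‖ ≤ η := by
  have h : ∀ᶠ l : ℤ in atBot, ∀ p ∈ s, ‖T p l‖ ≤ η := by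
    rw [Filter.eventually_all_finset]
    intro p _
    have h1 : Tendsto (T p) atBot (nhds 0) := (hT p).mono_left atBot_le_cofinite
    have h2 := h1.norm
    rw [norm_zero] at h2
    exact h2.eventually (ge_mem_nhds hη)
  obtain ⟨L, hL⟩ := eventually_atBot.1 h
  exact ⟨L, fun p hp l hl => hL l hl p hp⟩

/-- A pseudofunction can be perturbed, by little on the negative side and without enlarging its
support, so that on its support some power of `z` is close to prescribed unimodular constants. -/
lemma exists_step {S : ℤ → ℂ} (hS : Tendsto S cofinite (nhds 0)) (s : Finset (ℂ × ℂ))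
    (hs : ∀ p ∈ s, ‖p.2‖ = 1) {ρ ε δ : ℝ} (hρ : 0 < ρ) (hε : 0 < ε) (hε1 : ε ≤ 1) (hδ : 0 < δ)
    (hcov : ∀ z : ℂ, ‖z‖ = 1 → ∃ p ∈ s, ‖z - p.1‖ < ρ) :
    ∃ S' : ℤ → ℂ, Tendsto S' cofinite (nhds 0) ∧
      (∀ m : ℤ, ‖S' m - S m‖ ≤ δ * (1 + max (m : ℝ) 0)) ∧
      (∀ U, VanishesOn S U → VanishesOn S' U) ∧
      ∃ n : ℕ, ∀ U : Set ℂ, (∀ z ∈ U, ∀ p ∈ s, ρ ≤ ‖z - p.1‖ ∨ ε ≤ ‖z ^ n - p.2‖) →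
        VanishesOn S' U := by
  obtain ⟨B₀, -, hB₀⟩ := exists_bound_of_tendsto_cofinite hS
  obtain ⟨τ, hτ, hτ0, hτ1⟩ := exists_smooth_partition s Prod.fst hρ hcov
  set T : ℂ × ℂ → ℤ → ℂ := fun p => seqConv (testCoeff (τ p)) S with hTdef
  have hT : ∀ p, Tendsto (T p) cofinite (nhds 0) := fun p =>
    tendsto_seqConv_cofinite (summable_norm_testCoeff (hτ p)) hB₀ hS
  obtain ⟨B, hB0, hB⟩ := exists_uniform_bound s hT
  set N : ℝ := (s.card : ℝ) with hN
  have hN0 : 0 ≤ N := Nat.cast_nonneg _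
  obtain ⟨h, hh, hh0, b, hb, hbδ, hb0, hbh⟩ := exists_concentrated_kernel hε hε1
    (δ := δ / (2 * (N + 1) * (B + 1))) (by positivity)
  set M : ℝ := ∑' k, ‖testCoeff h k‖ with hM
  have hM0 : 0 ≤ M := tsum_nonneg fun k => norm_nonneg _
  set η : ℝ := δ / (2 * (N + 1) * (M + 1)) with hη
  have hη0 : 0 < η := by positivity
  obtain ⟨L, hL⟩ := exists_left_bound s hT hη0
  obtain ⟨n₁, hn₁⟩ := exists_nat_ge (N * M * B / δ - L)
  set n : ℕ := n₁ + 1 with hn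
  have hn0 : n ≠ 0 := Nat.succ_ne_zero _
  set H : ℂ × ℂ → ℝ → ℂ := fun p θ => h (n * θ - p.2.arg) with hH
  have hHs : ∀ p, PeriodicSmooth (H p) := fun p => hh.dilate n _
  have hTb : ∀ p, ∃ C, 0 ≤ C ∧ ∀ l, ‖T p l‖ ≤ C := fun p => exists_bound_of_tendsto_cofinite (hT p)
  choose C hC0 hC using hTb
  set S' : ℤ → ℂ := fun m => ∑ p ∈ s, seqConv (testCoeff (H p)) (T p) m with hS'
  have hS'b : ∀ p ∈ s, ∀ l, ‖seqConv (testCoeff (H p)) (T p) l‖ ≤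
      (∑' k, ‖testCoeff (H p) k‖) * C p := fun p _ l =>
    norm_seqConv_le (summable_norm_testCoeff (hHs p)) (hC p) l
  refine ⟨S', ?_, fun m => ?_, fun U hU => ?_, n, fun U hU => ?_⟩
  · rw [← Finset.sum_const_zero (s := s)]
    exact tendsto_finsetSum s fun p _ =>
      tendsto_seqConv_cofinite (summable_norm_testCoeff (hHs p)) (hC p) (hT p)
  · have hdiff : S' m - S m = ∑ p ∈ s, (seqConv (testCoeff (H p)) (T p) m - T p m) := by
      rw [Finset.sum_sub_distrib, sum_seqConv_partition hτ hτ1 hB₀]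
    have hsmall : N * ((∑' k, b k) * B) ≤ δ / 2 := by
      have h1 : N * ((∑' k, b k) * B) ≤ N * (δ / (2 * (N + 1) * (B + 1)) * B) := by gcongr
      refine h1.trans ?_
      rw [div_mul_eq_mul_div, ← mul_div_assoc, div_le_div_iff₀ (by positivity) two_pos]
      nlinarith [mul_nonneg hδ.le hN0, mul_nonneg hδ.le hB0]
    have hgen : ∀ η' : ℝ, (∀ p ∈ s, ∀ l : ℤ, l ≤ m - n → ‖T p l‖ ≤ η') →
        ‖S' m - S m‖ ≤ δ / 2 + N * (M * η') := by
      intro η' hη'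
      rw [hdiff]
      refine (norm_sum_le_of_le s fun p hp => norm_seqConv_dilate_sub_le hh hb hb0 hbh hn0
        p.2.arg (hB p hp) (hη' p hp)).trans ?_
      rw [Finset.sum_const, nsmul_eq_mul]
      linarith
    have hmax : 0 ≤ max (m : ℝ) 0 := le_max_right _ _
    rcases le_or_gt (m - n) L with hm | hm
    · refine (hgen η fun p hp l hl => hL p hp l (hl.trans hm)).trans ?_
      have h2 : N * (M * η) ≤ δ / 2 := by
        rw [hη, ← mul_div_assoc, ← mul_div_assoc, div_le_div_iff₀ (by positivity) two_pos]
        nlinarith [mul_nonneg hδ.le hN0, mul_nonneg hδ.le hM0]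
      nlinarith
    · refine (hgen B fun p hp l _ => hB p hp l).trans ?_
      have h3 : N * M * B / δ ≤ m := by
        have h4 : (L : ℝ) + n < m := by exact_mod_cast (by linarith : L + n < m)
        rw [hn] at h4
        push_cast at h4
        linarith
      rw [div_le_iff₀ hδ] at h3
      have h5 : (m : ℝ) ≤ max (m : ℝ) 0 := le_max_left _ _
      nlinarith
  · exact VanishesOn.finset_sum (fun p _ => (hU.seqConv (hτ p) hB₀).seqConv (hHs p) (hC p)) hS'b
  · refine VanishesOn.finset_sum (fun p hp ψ hψ h0 => ?_) hS'b
    rw [seqAct_seqConv (hHs p) hψ (hC p), seqAct_seqConv (hτ p) ((hHs p).mul hψ) hB₀]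
    have hzero : (fun θ => τ p θ * (H p θ * ψ θ)) = fun _ => 0 := by
      funext θ
      by_cases hθ : Complex.exp ((θ : ℂ) * Complex.I) ∈ U
      · rcases hU _ hθ p hp with h1 | h1
        · rw [hτ0 p θ h1, zero_mul]
        · have h2 : H p θ = 0 := by
            refine hh0 _ ?_
            have harg : Complex.exp ((p.2.arg : ℂ) * Complex.I) = p.2 := by
              have h3 := Complex.norm_mul_exp_arg_mul_I p.2
              rwa [hs p hp, ofReal_one, one_mul] at h3
            have hp0 : p.2 ≠ 0 := norm_ne_zero_iff.1 (by rw [hs p hp]; exact one_ne_zero)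
            rw [exp_natMul_sub_mul_I, harg, ← mul_inv_cancel₀ hp0, ← sub_mul, norm_mul, norm_inv,
              hs p hp, inv_one, mul_one]
            exact h1
          rw [h2, zero_mul, mul_zero]
      · rw [h0 θ hθ, mul_zero, mul_zero]
    rw [hzero, seqAct_zero]

/-- On the set `U` no pair `(ζ, c) ∈ s` satisfies both `‖z - ζ‖ < ρ` and `‖z ^ n - c‖ < ε`. -/
def FarFrom (s : Finset (ℂ × ℂ)) (ρ ε : ℝ) (n : ℕ) (U : Set ℂ) : Prop :=
  ∀ z ∈ U, ∀ p ∈ s, ρ ≤ ‖z - p.1‖ ∨ ε ≤ ‖z ^ n - p.2‖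

lemma VanishesOn.of_tendsto {S : ℕ → ℤ → ℂ} {S' : ℤ → ℂ} {U : Set ℂ} {C : ℝ}
    (hS : ∀ m, Tendsto (fun j => S j m) atTop (nhds (S' m)))
    (hC : ∀ j, ∀ m : ℤ, ‖S j m‖ ≤ C * (1 + |(m : ℝ)|)) (h : ∀ᶠ j in atTop, VanishesOn (S j) U) :
    VanishesOn S' U := by
  intro ψ hψ h0
  have hlim : Tendsto (fun j => seqAct (S j) ψ) atTop (nhds (seqAct S' ψ)) := by
    refine tendsto_tsum_of_dominated_convergence
      (bound := fun n : ℤ => C * ((1 + |(n : ℝ)|) * ‖testCoeff ψ (-n)‖))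
      ((summable_weighted_testCoeff_neg hψ).mul_left C)
      (fun n => (hS n).mul_const _) (.of_forall fun j n => ?_)
    rw [norm_mul, ← mul_assoc]
    gcongr
    exact hC j n
  refine tendsto_nhds_unique hlim (tendsto_const_nhds.congr' ?_)
  filter_upwards [h] with j hj
  exact (hj ψ hψ h0).symm

lemma exists_limit {S₀ : ℤ → ℂ} (hS₀ : Tendsto S₀ cofinite (nhds 0)) (hne : S₀ ≠ 0)
    (s : ℕ → Finset (ℂ × ℂ)) (hs : ∀ j, ∀ p ∈ s j, ‖p.2‖ = 1) {ρ ε : ℕ → ℝ} (hρ : ∀ j, 0 < ρ j)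
    (hε : ∀ j, 0 < ε j) (hε1 : ∀ j, ε j ≤ 1) :
    ∃ S : ℤ → ℂ, S ≠ 0 ∧ Tendsto S atBot (nhds 0) ∧
      (∃ C, ∀ m : ℤ, ‖S m‖ ≤ C * (1 + |(m : ℝ)|)) ∧
      (∀ U, VanishesOn S₀ U → VanishesOn S U) ∧
      ∀ j, (∀ z : ℂ, ‖z‖ = 1 → ∃ p ∈ s j, ‖z - p.1‖ < ρ j) →
        ∃ n : ℕ, ∀ U, FarFrom (s j) (ρ j) (ε j) n U → VanishesOn S U := by
  obtain ⟨m₀, hm₀⟩ : ∃ m, S₀ m ≠ 0 := by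
    by_contra! h
    exact hne (funext h)
  set w : ℤ → ℝ := fun m => 1 + max (m : ℝ) 0 with hw
  have hw1 : ∀ m, 1 ≤ w m := fun m => by simp [hw]
  have hwle : ∀ m, w m ≤ 1 + |(m : ℝ)| := fun m => by
    simp only [hw, add_le_add_iff_left]
    exact max_le (le_abs_self _) (abs_nonneg _)
  set δ : ℝ := ‖S₀ m₀‖ / (2 * w m₀) with hδ
  have hδ0 : 0 < δ := div_pos (norm_pos_iff.2 hm₀) (by linarith [hw1 m₀])
  have hstep : ∀ (j : ℕ) (S : {S : ℤ → ℂ // Tendsto S cofinite (nhds 0)}),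
      ∃ S' : {S : ℤ → ℂ // Tendsto S cofinite (nhds 0)},
        (∀ m, ‖S'.1 m - S.1 m‖ ≤ δ / 2 / 2 ^ j * w m) ∧
        (∀ U, VanishesOn S.1 U → VanishesOn S'.1 U) ∧
        ((∀ z : ℂ, ‖z‖ = 1 → ∃ p ∈ s j, ‖z - p.1‖ < ρ j) →
          ∃ n : ℕ, ∀ U, FarFrom (s j) (ρ j) (ε j) n U → VanishesOn S'.1 U) := by
    intro j S
    by_cases hcov : ∀ z : ℂ, ‖z‖ = 1 → ∃ p ∈ s j, ‖z - p.1‖ < ρ j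
    · obtain ⟨S', h0, h1, h2, h3⟩ := exists_step S.2 (s j) (hs j) (hρ j) (hε j) (hε1 j)
        (δ := δ / 2 / 2 ^ j) (by positivity) hcov
      exact ⟨⟨S', h0⟩, h1, h2, fun _ => h3⟩
    · refine ⟨S, fun m => ?_, fun U hU => hU, fun h => absurd h hcov⟩
      have := hw1 m
      rw [sub_self, norm_zero]
      positivity
  choose F hF1 hF2 hF3 using hstep
  let S : ℕ → {S : ℤ → ℂ // Tendsto S cofinite (nhds 0)} := fun j =>
    Nat.rec ⟨S₀, hS₀⟩ F j
  have hdist : ∀ m j, dist ((S j).1 m) ((S (j + 1)).1 m) ≤ δ * w m / 2 / 2 ^ j := by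
    intro m j
    rw [dist_comm, dist_eq_norm]
    refine (hF1 j (S j) m).trans_eq ?_
    ring
  have hlim : ∀ m, ∃ x, Tendsto (fun j => (S j).1 m) atTop (nhds x) := fun m =>
    cauchySeq_tendsto_of_complete (cauchySeq_of_le_geometric_two (hdist m))
  choose S' hS' using hlim
  have hclose : ∀ j m, ‖(S j).1 m - S' m‖ ≤ δ * w m / 2 ^ j := fun j m => by
    rw [← dist_eq_norm]
    exact dist_le_of_le_geometric_two_of_tendsto (hdist m) (hS' m) j
  have hclose0 : ∀ m, ‖S₀ m - S' m‖ ≤ δ * w m := fun m => by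
    have h := hclose 0 m
    rwa [pow_zero, div_one] at h
  have hmono : ∀ U i j, i ≤ j → VanishesOn (S i).1 U → VanishesOn (S j).1 U := by
    intro U i j hij hi
    induction j, hij using Nat.le_induction with
    | base => exact hi
    | succ j _ ih => exact hF2 j (S j) U ih
  obtain ⟨B, hB0, hB⟩ := exists_bound_of_tendsto_cofinite hS₀
  have hbound' : ∀ m : ℤ, ‖S' m‖ ≤ (B + δ) * (1 + |(m : ℝ)|) := by
    intro m
    have h1 := norm_sub_norm_le (S' m) (S₀ m)
    rw [norm_sub_rev] at h1
    have h2 := hclose0 m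
    have h3 := hB m
    have h4 := hwle m
    nlinarith [abs_nonneg (m : ℝ)]
  have hbound : ∀ j, ∀ m : ℤ, ‖(S j).1 m‖ ≤ (B + 2 * δ) * (1 + |(m : ℝ)|) := by
    intro j m
    have h1 := norm_sub_norm_le ((S j).1 m) (S' m)
    have h2 : ‖(S j).1 m - S' m‖ ≤ δ * w m := by
      refine (hclose j m).trans (div_le_self ?_ (one_le_pow₀ one_le_two))
      exact mul_nonneg hδ0.le (zero_le_one.trans (hw1 m))
    have h3 := hbound' m
    have h4 := hwle m
    nlinarith
  have hpass : ∀ U i, VanishesOn (S i).1 U → VanishesOn S' U := fun U i hi =>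
    VanishesOn.of_tendsto hS' hbound ((eventually_ge_atTop i).mono fun j hj => hmono U i j hj hi)
  refine ⟨S', fun h => ?_, ?_, ⟨_, hbound'⟩, fun U hU => hpass U 0 hU, fun j hcov => ?_⟩
  · have h1 := hclose0 m₀
    have h2 : δ * w m₀ = ‖S₀ m₀‖ / 2 := by
      have := (zero_lt_one.trans_le (hw1 m₀)).ne'
      rw [hδ]
      field_simp
    rw [h, Pi.zero_apply, sub_zero, h2] at h1
    linarith [norm_pos_iff.2 hm₀]
  · refine Metric.tendsto_nhds.2 fun η hη => ?_
    have hpow : Tendsto (fun j : ℕ => δ / 2 ^ j) atTop (nhds 0) :=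
      tendsto_const_nhds.div_atTop (tendsto_pow_atTop_atTop_of_one_lt one_lt_two)
    obtain ⟨j, hj⟩ := (hpow.eventually (gt_mem_nhds (half_pos hη))).exists
    have hSj : Tendsto (S j).1 atBot (nhds 0) := (S j).2.mono_left atBot_le_cofinite
    filter_upwards [Metric.tendsto_nhds.1 hSj (η / 2) (half_pos hη), eventually_le_atBot 0]
      with m hm hm0
    have h1 := hclose j m
    have h2 : w m = 1 := by
      simp only [hw]
      rw [max_eq_right (by exact_mod_cast hm0), add_zero]
    rw [h2, mul_one] at h1
    rw [dist_zero_right] at hm ⊢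
    have h3 := norm_sub_norm_le (S' m) ((S j).1 m)
    rw [norm_sub_rev] at h3
    linarith
  · obtain ⟨n, hn⟩ := hF3 j (S j) hcov
    exact ⟨n, fun U hU => hpass U (j + 1) (hn U hU)⟩

lemma not_vanishesOn_of_mem_distSupport {μ : CircleDistribution} {z : ℂ}
    (hz : z ∈ distSupport μ) {U : Set ℂ} (hU : IsOpen U) (hzU : z ∈ U) :
    ¬ VanishesOn μ.coeff U := by
  intro h
  obtain ⟨φ, hφ, h0, hne⟩ := hz.2 U hU hzU
  exact hne (h φ hφ h0)

lemma exists_vanishesOn_of_notMem_distSupport {μ : CircleDistribution} {z : ℂ}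
    (hz : z ∈ sphere (0 : ℂ) 1) (hzμ : z ∉ distSupport μ) :
    ∃ U : Set ℂ, IsOpen U ∧ z ∈ U ∧ VanishesOn μ.coeff U := by
  by_contra! h
  refine hzμ ⟨hz, fun U hU hzU => ?_⟩
  have h1 := h U hU hzU
  simp only [VanishesOn, not_forall] at h1
  obtain ⟨φ, hφ, h0, hne⟩ := h1
  exact ⟨φ, hφ, h0, hne⟩

lemma isCompact_distSupport (μ : CircleDistribution) : IsCompact (distSupport μ) := by
  have hopen : IsOpen (⋃₀ {U : Set ℂ | IsOpen U ∧ VanishesOn μ.coeff U}) :=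
    isOpen_sUnion fun U hU => hU.1
  have heq : distSupport μ =
      sphere (0 : ℂ) 1 \ ⋃₀ {U : Set ℂ | IsOpen U ∧ VanishesOn μ.coeff U} := by
    ext z
    constructor
    · rintro hz
      refine ⟨hz.1, ?_⟩
      rintro ⟨U, ⟨hU, hv⟩, hzU⟩
      exact not_vanishesOn_of_mem_distSupport hz hU hzU hv
    · rintro ⟨hz, hzU⟩
      by_contra hzμ
      obtain ⟨U, hU, hzU', hv⟩ := exists_vanishesOn_of_notMem_distSupport hz hzμ
      exact hzU ⟨U, ⟨hU, hv⟩, hzU'⟩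
  rw [heq]
  exact (isCompact_sphere 0 1).diff hopen

lemma distSupport_subset_of_vanishesOn {μ ν : CircleDistribution}
    (h : ∀ U, VanishesOn ν.coeff U → VanishesOn μ.coeff U) : distSupport μ ⊆ distSupport ν := by
  intro z hz
  by_contra hzν
  obtain ⟨U, hU, hzU, hv⟩ := exists_vanishesOn_of_notMem_distSupport hz.1 hzν
  exact not_vanishesOn_of_mem_distSupport hz hU hzU (h U hv)

lemma exists_near_of_mem_distSupport {μ : CircleDistribution} {s : Finset (ℂ × ℂ)} {ρ ε : ℝ}
    {n : ℕ} (h : ∀ U, FarFrom s ρ ε n U → VanishesOn μ.coeff U) {z : ℂ}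
    (hz : z ∈ distSupport μ) : ∃ p ∈ s, ‖z - p.1‖ ≤ ρ ∧ ‖z ^ n - p.2‖ ≤ ε := by
  by_contra! hfar
  set U : Set ℂ := ⋂ p ∈ s, ({x | ρ < ‖x - p.1‖} ∪ {x | ε < ‖x ^ n - p.2‖}) with hUdef
  have hU : IsOpen U := isOpen_biInter_finset fun p _ =>
    (isOpen_lt continuous_const (by fun_prop)).union (isOpen_lt continuous_const (by fun_prop))
  refine not_vanishesOn_of_mem_distSupport hz hU ?_ (h U fun x hx p hp => ?_)
  · refine mem_iInter₂.2 fun p hp => ?_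
    rcases lt_or_ge ρ ‖z - p.1‖ with h1 | h1
    · exact Or.inl h1
    · exact Or.inr (hfar p hp h1)
  · exact (mem_iInter₂.1 hx p hp).imp (fun h1 => le_of_lt h1) fun h1 => le_of_lt h1

/-- A criterion for Kronecker sets in terms of a dense sequence in the circle. -/
lemma isKronecker_of_approx {K : Set ℂ} (hK : IsCompact K) (hK1 : K ⊆ sphere (0 : ℂ) 1)
    {d : ℕ → sphere (0 : ℂ) 1} (hd : DenseRange d)
    (h : ∀ (N : ℕ) (F : Finset (ℕ × ℕ)),
      (∀ z : ℂ, ‖z‖ = 1 → ∃ p ∈ F, ‖z - d p.1‖ < 1 / ((N : ℝ) + 1)) →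
      ∃ n : ℕ, ∀ z ∈ K, ∃ p ∈ F, ‖z - d p.1‖ ≤ 1 / ((N : ℝ) + 1) ∧
        ‖z ^ n - d p.2‖ ≤ 1 / ((N : ℝ) + 1)) :
    IsKronecker K := by
  refine ⟨hK, hK1, fun f hf hf1 ε hε => ?_⟩
  have hdense : ∀ z : ℂ, ‖z‖ = 1 → ∀ r > 0, ∃ i, ‖z - d i‖ < r := by
    intro z hz r hr
    obtain ⟨i, hi⟩ := hd.exists_dist_lt ⟨z, by simpa using hz⟩ hr
    exact ⟨i, by rwa [Subtype.dist_eq, dist_eq_norm] at hi⟩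
  obtain ⟨δ, hδ, hfδ⟩ := Metric.uniformContinuousOn_iff.1
    (hK.uniformContinuousOn_of_continuous hf) (ε / 4) (by positivity)
  obtain ⟨N, hN⟩ := exists_nat_one_div_lt (show 0 < min (δ / 2) (ε / 4) by positivity)
  set r : ℝ := 1 / ((N : ℝ) + 1) with hr
  have hr0 : 0 < r := by positivity
  have hrδ : r < δ / 2 := hN.trans_le (min_le_left _ _)
  have hrε : r < ε / 4 := hN.trans_le (min_le_right _ _)
  obtain ⟨t, ht⟩ := (isCompact_sphere (0 : ℂ) 1).elim_finite_subcover
    (fun i => ball (d i : ℂ) r) (fun i => isOpen_ball) (fun z hz => by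
      obtain ⟨i, hi⟩ := hdense z (by simpa using hz) r hr0
      exact mem_iUnion.2 ⟨i, by rwa [mem_ball, dist_eq_norm]⟩)
  have hk : ∀ i, ∃ k, ∀ y ∈ K, ‖y - d i‖ ≤ r → ‖f y - d k‖ < ε / 2 := by
    intro i
    by_cases hy : ∃ y ∈ K, ‖y - d i‖ ≤ r
    · obtain ⟨y₀, hy₀, hy₀i⟩ := hy
      obtain ⟨k, hk⟩ := hdense (f y₀) (hf1 y₀ hy₀) (ε / 4) (by positivity)
      refine ⟨k, fun y hyK hyi => ?_⟩
      have h1 : dist y y₀ < δ := by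
        have h2 := dist_triangle_right y y₀ (d i : ℂ)
        rw [dist_eq_norm y (d i : ℂ), dist_eq_norm y₀] at h2
        linarith
      have h3 := hfδ y hyK y₀ hy₀ h1
      rw [dist_eq_norm] at h3
      have h4 := norm_sub_le_norm_sub_add_norm_sub (f y) (f y₀) (d k : ℂ)
      linarith
    · push Not at hy
      exact ⟨0, fun y hyK hyi => absurd hyi (hy y hyK).not_ge⟩
  choose k hk using hk
  obtain ⟨n, hn⟩ := h N (t.image fun i => (i, k i)) (fun z hz => by
    obtain ⟨i, hi, hzi⟩ := mem_iUnion₂.1 (ht (by simpa using hz : z ∈ sphere (0 : ℂ) 1))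
    exact ⟨(i, k i), Finset.mem_image_of_mem _ hi, by rwa [mem_ball, dist_eq_norm] at hzi⟩)
  refine ⟨n, fun z hz => ?_⟩
  obtain ⟨p, hp, hzp, hznp⟩ := hn z hz
  obtain ⟨i, -, rfl⟩ := Finset.mem_image.1 hp
  have h1 := hk i z hz hzp
  have h2 := norm_sub_le_norm_sub_add_norm_sub (f z) (d (k i) : ℂ) (z ^ n)
  rw [norm_sub_rev (d (k i) : ℂ)] at h2
  rw [zpow_natCast]
  dsimp only at hznp
  linarith

/-- If `E` is a set of multiplicity, then there is a nonzero distribution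
`μ` on the circle whose support is a Kronecker subset of `E` and whose Fourier
coefficients satisfy `μ̂(n) → 0` as `n → -∞`. -/
theorem stmt_12 (E : Set ℂ) (hE : IsMSet E) :
    ∃ μ : CircleDistribution, μ.coeff ≠ 0 ∧
      IsKronecker (distSupport μ) ∧ distSupport μ ⊆ E ∧
      Filter.Tendsto μ.coeff Filter.atBot (nhds 0) := by
  obtain ⟨-, -, μ₀, hne, hsupp, hμ₀⟩ := hE
  have : Nonempty (sphere (0 : ℂ) 1) := ⟨⟨1, by simp⟩⟩
  obtain ⟨d, hd⟩ := TopologicalSpace.exists_dense_seq (sphere (0 : ℂ) 1)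
  obtain ⟨e, he⟩ := exists_surjective_nat (ℕ × Finset (ℕ × ℕ))
  have hone : ∀ i, ‖(d i : ℂ)‖ = 1 := fun i => by simp
  obtain ⟨S, hS0, hSlim, ⟨C, hC⟩, hSsupp, hSnear⟩ := exists_limit hμ₀ hne
    (fun j => (e j).2.image fun q => ((d q.1 : ℂ), (d q.2 : ℂ)))
    (fun j p hp => by
      obtain ⟨q, -, rfl⟩ := Finset.mem_image.1 hp
      exact hone q.2)
    (ρ := fun j => 1 / (((e j).1 : ℝ) + 1)) (ε := fun j => 1 / (((e j).1 : ℝ) + 1))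
    (fun j => by positivity) (fun j => by positivity)
    (fun j => by
      rw [div_le_one (by positivity)]
      linarith [Nat.cast_nonneg (α := ℝ) (e j).1])
  let μ : CircleDistribution := ⟨S, C, 1, fun n => by
    rw [pow_one, Nat.cast_natAbs, Int.cast_abs]
    exact hC n⟩
  refine ⟨μ, hS0, ?_, (distSupport_subset_of_vanishesOn (μ := μ) hSsupp).trans hsupp, hSlim⟩
  refine isKronecker_of_approx (isCompact_distSupport μ) (fun z hz => hz.1) hd fun N F hcov => ?_
  obtain ⟨j, hj⟩ := he (N, F)
  have hnear := hSnear j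
  rw [hj] at hnear
  obtain ⟨n, hn⟩ := hnear fun z hz => by
    obtain ⟨p, hp, hzp⟩ := hcov z hz
    exact ⟨_, Finset.mem_image_of_mem _ hp, hzp⟩
  refine ⟨n, fun z hz => ?_⟩
  obtain ⟨p, hp, h1, h2⟩ := exists_near_of_mem_distSupport (μ := μ) hn hz
  obtain ⟨q, hq, rfl⟩ := Finset.mem_image.1 hp
  exact ⟨q, hq, h1, h2⟩
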